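/- Let 1 ≤ m ≤ n be integers. For the fermionic Gaussian ensemble with arbitrary particle number, the variance of the von Neumann entropy equals V[S] = (1/2 − m − n)·ψ₁(2m+2n) + (n − 1/2)·ψ₁(2n) + (m(2m+n−1)/(2m+2n−1) − 1/8)·ψ₁(m+n) + (1/8)·ψ₁(n) − (1/2)·(ψ₀(2m+2n) − ψ₀(2n)). -/

import Mathlib

open MeasureTheory Real Finset

/-- The entropy integrand `v(x) = (1-x)/2 · ln((1-x)/2) + (1+x)/2 · ln((1+x)/2)`. -/
noncomputable def vEnt (x : ℝ) : ℝ :=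
  (1 - x) / 2 * Real.log ((1 - x) / 2) + (1 + x) / 2 * Real.log ((1 + x) / 2)

/-- Digamma function at a positive integer: `ψ₀(k) = -γ + Σ_{j=1}^{k-1} 1/j`. -/
noncomputable def psi0 (k : ℕ) : ℝ :=
  -Real.eulerMascheroniConstant + ∑ j ∈ Finset.range (k - 1), 1 / (j + 1 : ℝ)

/-- Trigamma function at a positive integer: `ψ₁(k) = π²/6 - Σ_{j=1}^{k-1} 1/j²`. -/
noncomputable def psi1 (k : ℕ) : ℝ :=
  Real.pi ^ 2 / 6 - ∑ j ∈ Finset.range (k - 1), 1 / ((j + 1 : ℝ)) ^ 2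

/-- The unnormalized fermionic-Gaussian eigenvalue density with arbitrary particle number. -/
noncomputable def densityA (m n : ℕ) (x : Fin m → ℝ) : ℝ :=
  if ∀ i, x i ∈ Set.Icc (0 : ℝ) 1 then
    (∏ p ∈ Finset.univ.filter (fun p : Fin m × Fin m => p.1 < p.2),
      ((x p.1) ^ 2 - (x p.2) ^ 2) ^ 2) * ∏ i, (1 - (x i) ^ 2) ^ (n - m)
  else 0

/-- The von Neumann entropy `S(x) = -Σ_i v(x_i)`. -/
noncomputable def entS {m : ℕ} (x : Fin m → ℝ) : ℝ := -∑ i, vEnt (x i)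

/-- Ensemble average of `g` with respect to the density `f`. -/
noncomputable def ensembleAvg {m : ℕ} (f : (Fin m → ℝ) → ℝ) (g : (Fin m → ℝ) → ℝ) : ℝ :=
  (∫ x, g x * f x) / (∫ x, f x)

/-- Ensemble variance of `g`: `V[g] = E[g²] − E[g]²`. -/
noncomputable def ensembleVar {m : ℕ} (f : (Fin m → ℝ) → ℝ) (g : (Fin m → ℝ) → ℝ) : ℝ :=
  ensembleAvg f (fun x => (g x) ^ 2) - (ensembleAvg f g) ^ 2

section
open MeasureTheory Real Finset

namespace VA

noncomputable def gP (a : ℕ) (z : ℝ) : ℝ := ∏ i ∈ Finset.range a, (z ^ 2 - ((i : ℝ) + 1 / 2) ^ 2)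

lemma gP_zero (z : ℝ) : gP 0 z = 1 := by simp [gP]

lemma gP_succ (a : ℕ) (z : ℝ) : gP (a + 1) z = gP a z * (z ^ 2 - ((a : ℝ) + 1 / 2) ^ 2) := by
  simp [gP, Finset.prod_range_succ]

lemma gP_shift (a : ℕ) (z : ℝ) : gP a (z + 1) * (z - a + 1 / 2) = gP a z * (z + a + 1 / 2) := by
  induction a with
  | zero => simp [gP_zero]
  | succ a ih =>
    rw [gP_succ, gP_succ]; push_cast
    linear_combination ((z + a + 3 / 2) * (z - a - 1 / 2)) * ih

lemma gP_pos (a : ℕ) (z : ℝ) (h : (a : ℝ) - 1 / 2 < z) : 0 < gP a z := by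
  unfold gP
  refine Finset.prod_pos fun i hi => ?_
  have : (i : ℝ) + 1 ≤ a := by exact_mod_cast Finset.mem_range.mp hi
  have h0 : (0 : ℝ) ≤ i := Nat.cast_nonneg i
  nlinarith

lemma gP_eq_zero (a i : ℕ) (h : i < a) : gP a ((i : ℝ) + 1 / 2) = 0 := by
  unfold gP
  exact Finset.prod_eq_zero (Finset.mem_range.mpr h) (by ring)

lemma gP_eq_zero' (a i : ℕ) (h : i < a) (z : ℝ) (hz : z = (i : ℝ) + 1 / 2) : gP a z = 0 := by
  rw [hz]; exact gP_eq_zero a i h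

lemma gP_ge_one (a : ℕ) (z : ℝ) (h : (a : ℝ) + 1 / 2 ≤ z) : 1 ≤ gP a z := by
  induction a with
  | zero => simp [gP_zero]
  | succ a ih =>
    have h0 : (0 : ℝ) ≤ a := Nat.cast_nonneg a
    push_cast at h
    rw [gP_succ]
    have h1 := ih (by linarith)
    have h2 : 1 ≤ z ^ 2 - ((a : ℝ) + 1 / 2) ^ 2 := by nlinarith
    nlinarith

lemma gP_ge (a : ℕ) (z : ℝ) (h : (a : ℝ) + 3 / 2 ≤ z) : z ^ 2 - 1 / 4 ≤ gP (a + 1) z := by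
  have h0 : (0 : ℝ) ≤ a := Nat.cast_nonneg a
  induction a with
  | zero => rw [gP_succ, gP_zero]; simp; norm_num
  | succ a ih =>
    have ha : (0 : ℝ) ≤ a := Nat.cast_nonneg a
    push_cast at h
    have := ih (by linarith) ha
    rw [gP_succ]; push_cast
    have h2 : 1 ≤ z ^ 2 - ((a : ℝ) + 1 + 1 / 2) ^ 2 := by nlinarith
    have h3 : 0 ≤ z ^ 2 - 1 / 4 := by nlinarith
    nlinarith

/-- outer and inner nodes -/
noncomputable def Yk (s k : ℕ) : ℝ := (s : ℝ) + 5 / 2 + 2 * k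
noncomputable def Xi (s i : ℕ) : ℝ := (s : ℝ) - 3 / 2 - 2 * i

noncomputable def Qf (s a : ℕ) (r : ℝ) (k : ℕ) : ℝ := Yk s k / (gP a (Yk s k) * (Yk s k ^ 2 - r ^ 2))
noncomputable def Pf (s a : ℕ) (r : ℝ) (k : ℕ) : ℝ :=
  Yk s k / (gP a (Yk s k) * (Yk s k ^ 2 - r ^ 2) ^ 2)
noncomputable def Qt (s a : ℕ) (r : ℝ) : ℝ :=
  ∑ i ∈ Finset.range (s / 2), Xi s i * gP a (Xi s i) / (r ^ 2 - Xi s i ^ 2)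
noncomputable def Pt (s a : ℕ) (r : ℝ) : ℝ :=
  ∑ i ∈ Finset.range (s / 2), Xi s i * gP a (Xi s i) / (r ^ 2 - Xi s i ^ 2) ^ 2
noncomputable def Qs (s a : ℕ) (r : ℝ) : ℝ := ∑' k, Qf s a r k
noncomputable def Ps (s a : ℕ) (r : ℝ) : ℝ := ∑' k, Pf s a r k

lemma Yk_gt (s k : ℕ) : (s : ℝ) + 5 / 2 ≤ Yk s k := by
  unfold Yk; have : (0 : ℝ) ≤ k := Nat.cast_nonneg k; linarith

lemma Yk_pos (s k : ℕ) : 0 < Yk s k := by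
  have := Yk_gt s k; have h : (0 : ℝ) ≤ s := Nat.cast_nonneg s; linarith

lemma gY_pos (s a k : ℕ) (ha : a ≤ s + 2) : 0 < gP a (Yk s k) := by
  apply gP_pos
  have := Yk_gt s k
  have h : (a : ℝ) ≤ s + 2 := by exact_mod_cast ha
  linarith

lemma Ydiff (s k : ℕ) (r : ℝ) (hr : r ^ 2 ≤ ((s : ℝ) + 3 / 2) ^ 2) :
    (2 * k + 1) * Yk s k ≤ Yk s k ^ 2 - r ^ 2 := by
  unfold Yk
  have : (0 : ℝ) ≤ k := Nat.cast_nonneg k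
  have h : (0 : ℝ) ≤ s := Nat.cast_nonneg s
  nlinarith

lemma Ydiff_pos (s k : ℕ) (r : ℝ) (hr : r ^ 2 ≤ ((s : ℝ) + 3 / 2) ^ 2) :
    0 < Yk s k ^ 2 - r ^ 2 := by
  have := Ydiff s k r hr
  have h2 := Yk_pos s k
  have : (0 : ℝ) ≤ k := Nat.cast_nonneg k
  nlinarith [mul_pos (by positivity : (0 : ℝ) < 2 * k + 1) h2]

lemma summ_aux : Summable fun k : ℕ => 1 / ((k : ℝ) + 1) ^ 2 := by
  have := (summable_nat_add_iff 1).mpr (Real.summable_one_div_nat_pow.mpr (by norm_num : 1 < 2))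
  simpa using this

lemma Pf_summable (s a : ℕ) (r : ℝ) (ha : a ≤ s + 2) (hr : r ^ 2 ≤ ((s : ℝ) + 3 / 2) ^ 2) :
    Summable (Pf s a r) := by
  have hY := Yk_pos s
  have hg := fun k => gY_pos s a k ha
  refine Summable.of_nonneg_of_le (fun k => ?_) (fun k => ?_) summ_aux
  · unfold Pf; have := hY k; have := hg k; positivity
  · unfold Pf
    have h1 := hY k
    have h2 : 1 ≤ gP a (Yk s k) := by
      apply gP_ge_one
      have := Yk_gt s k
      have h : (a : ℝ) ≤ s + 2 := by exact_mod_cast ha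
      linarith
    have h3 := Ydiff s k r hr
    have hk : (0 : ℝ) ≤ k := Nat.cast_nonneg k
    have h5 : 1 ≤ Yk s k := by
      have := Yk_gt s k; have h : (0 : ℝ) ≤ s := Nat.cast_nonneg s; linarith
    have h4 : ((k : ℝ) + 1) * Yk s k ≤ Yk s k ^ 2 - r ^ 2 := by nlinarith
    have h6 : (((k : ℝ) + 1) * Yk s k) ^ 2 ≤ (Yk s k ^ 2 - r ^ 2) ^ 2 :=
      pow_le_pow_left₀ (by positivity) h4 2
    have h8 := Ydiff_pos s k r hr
    rw [div_le_div_iff₀ (mul_pos (hg k) (pow_pos h8 2)) (by positivity)]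
    have h7 : (Yk s k) * ((k : ℝ) + 1) ^ 2 ≤ (((k : ℝ) + 1) * Yk s k) ^ 2 := by
      rw [mul_pow]; nlinarith [sq_nonneg ((k : ℝ) + 1)]
    nlinarith [sq_nonneg (Yk s k ^ 2 - r ^ 2)]

lemma Qf_summable (s a : ℕ) (r : ℝ) (ha1 : 1 ≤ a) (ha : a ≤ s + 2)
    (hr : r ^ 2 ≤ ((s : ℝ) + 3 / 2) ^ 2) :
    Summable (Qf s a r) := by
  have hY := Yk_pos s
  have hg := fun k => gY_pos s a k ha
  refine Summable.of_nonneg_of_le (fun k => ?_) (fun k => ?_) summ_aux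
  · unfold Qf; have := hY k; have := hg k; have := Ydiff_pos s k r hr; positivity
  · unfold Qf
    have h1 := hY k
    have h2 : Yk s k ^ 2 - 1 / 4 ≤ gP a (Yk s k) := by
      obtain ⟨b, rfl⟩ : ∃ b, a = b + 1 := ⟨a - 1, by omega⟩
      apply gP_ge
      have := Yk_gt s k
      have h : (b : ℝ) + 1 ≤ s + 2 := by exact_mod_cast ha
      linarith
    have h3 := Ydiff s k r hr
    have hk : (0 : ℝ) ≤ k := Nat.cast_nonneg k
    have h5 : 2 * (k : ℝ) + 5 / 2 ≤ Yk s k := by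
      unfold Yk; have h : (0 : ℝ) ≤ s := Nat.cast_nonneg s; linarith
    have h4 : Yk s k ≤ Yk s k ^ 2 - r ^ 2 := by nlinarith
    have h6 : ((k : ℝ) + 1) ^ 2 ≤ gP a (Yk s k) := by nlinarith
    have h7 : 0 < gP a (Yk s k) := hg k
    rw [div_le_div_iff₀ (mul_pos h7 (by linarith)) (by positivity)]
    nlinarith [mul_le_mul h6 h4 h1.le h7.le]

/-- recurrences in `a` for the outer sums -/
lemma P_rec (s a : ℕ) (r : ℝ) (ha : a ≤ s + 1) (hr : r ^ 2 ≤ ((s : ℝ) + 3 / 2) ^ 2) :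
    Ps s a r = (r ^ 2 - ((a : ℝ) + 1 / 2) ^ 2) * Ps s (a + 1) r + Qs s (a + 1) r := by
  unfold Ps Qs
  rw [← tsum_mul_left, ← Summable.tsum_add ((Pf_summable s (a + 1) r (by omega) hr).mul_left _)
    (Qf_summable s (a + 1) r (by omega) (by omega) hr)]
  refine tsum_congr fun k => ?_
  have h1 := gY_pos s a k (by omega)
  have h2 := gY_pos s (a + 1) k (by omega)
  have h3 := Ydiff_pos s k r hr
  unfold Pf Qf
  rw [gP_succ] at h2 ⊢
  have h4 : (Yk s k ^ 2 - ((a : ℝ) + 1 / 2) ^ 2) ≠ 0 := by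
    intro h; rw [h] at h2; simp at h2
  have h5 := h1.ne'
  have h6 := h3.ne'
  clear h1 h2 h3 hr
  generalize ((a : ℝ) + 1 / 2) ^ 2 = e at *
  field_simp
  ring

noncomputable def sg (s a : ℕ) : ℝ :=
  ((s : ℝ) + a + 2) / (4 * a * gP a ((s : ℝ) + 5 / 2) * ((s : ℝ) - a + 2))

lemma gP_shift2 (a : ℕ) (z : ℝ) :
    gP a (z + 2) * ((z - a + 1 / 2) * (z - a + 3 / 2)) =
      gP a z * ((z + a + 1 / 2) * (z + a + 3 / 2)) := by
  have h1 := gP_shift a z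
  have h2 := gP_shift a (z + 1)
  rw [show z + 1 + 1 = z + 2 by ring] at h2
  linear_combination (z - a + 1 / 2) * h2 + (z + a + 3 / 2) * h1

lemma sg_hasSum (s a : ℕ) (ha1 : 1 ≤ a) (ha : a ≤ s + 1) :
    HasSum (fun k => Yk s k / gP (a + 1) (Yk s k)) (sg s a) := by
  have hA : (a : ℝ) ≤ s + 1 := by exact_mod_cast ha
  have hA1 : (1 : ℝ) ≤ a := by exact_mod_cast ha1
  have key : ∀ K : ℕ, ∑ k ∈ Finset.range K, Yk s k / gP (a + 1) (Yk s k) =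
      sg s a - (Yk s K + a - 1 / 2) / (4 * a * gP a (Yk s K) * (Yk s K - a - 1 / 2)) := by
    intro K
    induction K with
    | zero =>
      simp only [Finset.range_zero, Finset.sum_empty, sg, Yk, Nat.cast_zero]
      rw [eq_comm, sub_eq_zero]; ring_nf
    | succ K ih =>
      rw [Finset.sum_range_succ, ih]
      have e : Yk s (K + 1) = Yk s K + 2 := by unfold Yk; push_cast; ring
      have h0 := Yk_gt s K
      have h1 := gY_pos s a K (by omega)
      have h2 := gP_shift2 a (Yk s K)
      have h3 := gY_pos s a (K + 1) (by omega)
      rw [e] at h3 ⊢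
      rw [gP_succ]
      set y := Yk s K
      obtain ⟨z, hz⟩ : ∃ z, z = y - a - 1 / 2 := ⟨_, rfl⟩
      have hy : y = z + a + 1 / 2 := by linarith
      have p3 : 0 < z := by linarith
      have e2 : gP a (y + 2) = gP a y * ((z + 2 * a + 1) * (z + 2 * a + 2)) /
          ((z + 1) * (z + 2)) := by
        rw [eq_div_iff (by positivity)]
        rw [hy] at h2 ⊢
        linear_combination h2
      have e3 : y ^ 2 - ((a : ℝ) + 1 / 2) ^ 2 = z * (z + 2 * a + 1) := by rw [hy]; ring
      have e4 : y + 2 - a - 1 / 2 = z + 2 := by rw [hy]; ring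
      have e5 : y + 2 + a - 1 / 2 = z + 2 * a + 2 := by rw [hy]; ring
      have e6 : y - a - 1 / 2 = z := by rw [hy]; ring
      have e7 : y + a - 1 / 2 = z + 2 * a := by rw [hy]; ring
      rw [e2, e3, e4, e5, e6, e7]
      have hG := h1.ne'
      generalize gP a y = G at *
      generalize sg s a = S at *
      rw [sub_add, sub_right_inj, hy]
      have q1 : z + 2 * a + 1 ≠ 0 := by positivity
      have q2 : z + 2 * a + 2 ≠ 0 := by positivity
      have q3 : z + 1 ≠ 0 := by positivity
      have q4 : z + 2 ≠ 0 := by positivity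
      have q5 : (a : ℝ) ≠ 0 := by linarith
      have q6 := p3.ne'
      field_simp
      ring
  have hpos : ∀ k, 0 ≤ Yk s k / gP (a + 1) (Yk s k) := fun k =>
    div_nonneg (Yk_pos s k).le (gY_pos s (a + 1) k (by omega)).le
  rw [hasSum_iff_tendsto_nat_of_nonneg hpos]
  simp_rw [key]
  suffices h : Filter.Tendsto (fun K => (Yk s K + a - 1 / 2) /
      (4 * a * gP a (Yk s K) * (Yk s K - a - 1 / 2))) Filter.atTop (nhds 0) by
    simpa using h.const_sub (sg s a)
  refine squeeze_zero (g := fun K : ℕ => ((s : ℝ) + a + 5) * (1 / ((K : ℝ) + 1))) (fun K => ?_) (fun K => ?_) ?_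
  · have h0 := Yk_gt s K
    have h1 := gY_pos s a K (by omega)
    refine div_nonneg (by linarith) (mul_nonneg (by positivity) (by linarith))
  · have h0 := Yk_gt s K
    have h1 := gY_pos s a K (by omega)
    have hk : (0 : ℝ) ≤ K := Nat.cast_nonneg K
    have hs : (0 : ℝ) ≤ s := Nat.cast_nonneg s
    have h5 : Yk s K = s + 5 / 2 + 2 * K := rfl
    have h2 : Yk s K ^ 2 - 1 / 4 ≤ gP a (Yk s K) := by
      obtain ⟨b, rfl⟩ : ∃ b, a = b + 1 := ⟨a - 1, by omega⟩
      apply gP_ge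
      push_cast at hA
      linarith
    have h6 : Yk s K * (K + 1) ≤ 4 * a * gP a (Yk s K) := by
      have : Yk s K * (K + 1) ≤ gP a (Yk s K) := by nlinarith
      nlinarith
    have h7 : 1 ≤ Yk s K - a - 1 / 2 := by linarith
    have h8 : Yk s K * (K + 1) ≤ 4 * a * gP a (Yk s K) * (Yk s K - a - 1 / 2) :=
      le_trans h6 (le_mul_of_one_le_right (by positivity) h7)
    have h9 : 0 < Yk s K * (K + 1) := by nlinarith
    rw [mul_one_div, div_le_div_iff₀ (by linarith) (by linarith)]
    have h10 : Yk s K + a - 1 / 2 ≤ (s + a + 5) * Yk s K := by nlinarith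
    nlinarith
  · have := tendsto_one_div_add_atTop_nhds_zero_nat (𝕜 := ℝ)
    simpa using this.const_mul ((s : ℝ) + a + 5)

lemma Q_rec (s a : ℕ) (r : ℝ) (ha1 : 1 ≤ a) (ha : a ≤ s + 1) (hr : r ^ 2 ≤ ((s : ℝ) + 3 / 2) ^ 2) :
    Qs s a r = (r ^ 2 - ((a : ℝ) + 1 / 2) ^ 2) * Qs s (a + 1) r + sg s a := by
  unfold Qs
  rw [← (sg_hasSum s a ha1 ha).tsum_eq]
  rw [← tsum_mul_left, ← Summable.tsum_add ((Qf_summable s (a + 1) r (by omega) (by omega) hr).mul_left _)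
    (sg_hasSum s a ha1 ha).summable]
  refine tsum_congr fun k => ?_
  have h1 := gY_pos s a k (by omega)
  have h2 := gY_pos s (a + 1) k (by omega)
  have h3 := Ydiff_pos s k r hr
  unfold Qf
  rw [gP_succ] at h2 ⊢
  have h4 : (Yk s k ^ 2 - ((a : ℝ) + 1 / 2) ^ 2) ≠ 0 := by
    intro h; rw [h] at h2; simp at h2
  have h5 := h1.ne'
  have h6 := h3.ne'
  clear h1 h2 h3 hr
  generalize ((a : ℝ) + 1 / 2) ^ 2 = e at *
  field_simp
  ring

noncomputable def sgt (s a : ℕ) : ℝ :=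
  gP a ((s : ℝ) + 1 / 2) * ((s : ℝ) - a) * ((s : ℝ) - a - 1) / (4 * ((a : ℝ) + 1))

lemma sgt_aux (a : ℕ) (y : ℝ) :
    gP a (y + 2) * (y + 2 - a - 1 / 2) * (y + 2 - a - 3 / 2)
      = gP a y * (y - a - 1 / 2) * (y - a - 3 / 2) + 4 * (a + 1) * y * gP a y := by
  have := gP_shift2 a y
  linear_combination this

lemma sgt_eq (s a : ℕ) : ∑ i ∈ Finset.range (s / 2), Xi s i * gP a (Xi s i) = sgt s a := by
  have h4 : (4 * ((a : ℝ) + 1)) ≠ 0 := by positivity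
  induction s using Nat.twoStepInduction with
  | zero =>
    cases a with
    | zero => simp [sgt]
    | succ a => 
      unfold sgt
      rw [gP_eq_zero' (a + 1) 0 (by omega) _ rfl]; simp
  | one =>
    cases a with
    | zero => simp [sgt]
    | succ a =>
      cases a with
      | zero => simp [sgt]
      | succ a => 
        unfold sgt
        rw [gP_eq_zero' (a + 1 + 1) 1 (by omega) _ rfl]; simp
  | more s ih _ =>
    rw [show (s + 2) / 2 = s / 2 + 1 by omega, Finset.sum_range_succ']
    have e : ∀ i, Xi (s + 2) (i + 1) = Xi s i := fun i => by unfold Xi; push_cast; ring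
    simp_rw [e, ih]
    have e0 : Xi (s + 2) 0 = s + 1 / 2 := by unfold Xi; push_cast; ring
    rw [e0]
    unfold sgt
    have := sgt_aux a ((s : ℝ) + 1 / 2)
    rw [div_add' _ _ _ h4, div_left_inj' h4]
    push_cast
    rw [show (s : ℝ) + 2 + 1 / 2 = s + 1 / 2 + 2 by ring]
    linear_combination -this

lemma Pt_rec (s a : ℕ) (r : ℝ) (hr : ∀ i < s / 2, r ^ 2 - Xi s i ^ 2 ≠ 0) :
    Pt s (a + 1) r = (r ^ 2 - ((a : ℝ) + 1 / 2) ^ 2) * Pt s a r - Qt s a r := by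
  unfold Pt Qt
  rw [Finset.mul_sum, ← Finset.sum_sub_distrib]
  refine Finset.sum_congr rfl fun i hi => ?_
  have := hr i (Finset.mem_range.mp hi)
  rw [gP_succ]
  field_simp
  ring

lemma Qt_rec (s a : ℕ) (r : ℝ) (hr : ∀ i < s / 2, r ^ 2 - Xi s i ^ 2 ≠ 0) :
    Qt s (a + 1) r = (r ^ 2 - ((a : ℝ) + 1 / 2) ^ 2) * Qt s a r - sgt s a := by
  rw [← sgt_eq]
  unfold Qt
  rw [Finset.mul_sum, ← Finset.sum_sub_distrib]
  refine Finset.sum_congr rfl fun i hi => ?_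
  have := hr i (Finset.mem_range.mp hi)
  rw [gP_succ]
  field_simp
  ring

lemma Xi_bound (s i : ℕ) (hi : i < s / 2) : 1 / 2 ≤ Xi s i ∧ Xi s i ≤ (s : ℝ) - 3 / 2 := by
  unfold Xi
  have h : 2 * i + 2 ≤ s := by omega
  have h' : 2 * (i : ℝ) + 2 ≤ s := by exact_mod_cast h
  have : (0 : ℝ) ≤ i := Nat.cast_nonneg i
  constructor <;> linarith

lemma Xi_ne (s i : ℕ) (hi : i < s / 2) (r : ℝ) (hr : (s : ℝ) - 1 / 2 ≤ r) : r ^ 2 - Xi s i ^ 2 ≠ 0 := by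
  obtain ⟨h1, h2⟩ := Xi_bound s i hi
  apply ne_of_gt; nlinarith

/-- the inner sums vanish for large `a` -/
lemma gX_zero (s a i : ℕ) (hi : i < s / 2) (ha : s ≤ a + 1) : gP a (Xi s i) = 0 := by
  apply gP_eq_zero' a (s - 2 - 2 * i) (by omega)
  unfold Xi
  have h : 2 * i + 2 ≤ s := by omega
  rw [Nat.cast_sub (by omega), Nat.cast_sub (by omega)]; push_cast; ring

lemma Qt_zero (s a : ℕ) (r : ℝ) (ha : s ≤ a + 1) : Qt s a r = 0 := by
  unfold Qt
  refine Finset.sum_eq_zero fun i hi => ?_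
  rw [gX_zero s a i (Finset.mem_range.mp hi) ha]; simp

lemma Pt_zero (s a : ℕ) (r : ℝ) (ha : s ≤ a + 1) : Pt s a r = 0 := by
  unfold Pt
  refine Finset.sum_eq_zero fun i hi => ?_
  rw [gX_zero s a i (Finset.mem_range.mp hi) ha]; simp

end VA
end

section
open MeasureTheory Real Finset

namespace VA

lemma psi1_succ (k : ℕ) (hk : 1 ≤ k) : psi1 (k + 1) = psi1 k - 1 / (k : ℝ) ^ 2 := by
  obtain ⟨j, rfl⟩ : ∃ j, k = j + 1 := ⟨k - 1, by omega⟩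
  unfold psi1
  simp only [Nat.add_sub_cancel]
  rw [Finset.sum_range_succ]; push_cast; ring

lemma psi0_succ (k : ℕ) (hk : 1 ≤ k) : psi0 (k + 1) = psi0 k + 1 / (k : ℝ) := by
  obtain ⟨j, rfl⟩ : ∃ j, k = j + 1 := ⟨k - 1, by omega⟩
  unfold psi0
  simp only [Nat.add_sub_cancel]
  rw [Finset.sum_range_succ]; push_cast; ring

lemma psi1_hasSum (j : ℕ) (hj : 1 ≤ j) :
    HasSum (fun k : ℕ => 1 / ((j : ℝ) + k) ^ 2) (psi1 j) := by
  obtain ⟨j, rfl⟩ : ∃ i, j = i + 1 := ⟨j - 1, by omega⟩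
  have h := (hasSum_nat_add_iff' (j + 1)).mpr hasSum_zeta_two
  have e : psi1 (j + 1) = Real.pi ^ 2 / 6 - ∑ i ∈ Finset.range (j + 1), 1 / (i : ℝ) ^ 2 := by
    unfold psi1
    rw [Finset.sum_range_succ']; simp
  rw [e]
  have e2 : (fun k : ℕ => 1 / (((j + 1 : ℕ) : ℝ) + k) ^ 2) =
      fun k : ℕ => 1 / ((k + (j + 1) : ℕ) : ℝ) ^ 2 := by
    funext k; push_cast; ring
  rw [e2]
  exact h

noncomputable def TT (j : ℕ) : ℝ := ∑' k : ℕ, 1 / ((j : ℝ) + 2 * k) ^ 2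

lemma TT_summable (j : ℕ) (hj : 1 ≤ j) : Summable fun k : ℕ => 1 / ((j : ℝ) + 2 * k) ^ 2 := by
  refine Summable.of_nonneg_of_le (fun k => by positivity) (fun k => ?_) summ_aux
  have h1 : (1 : ℝ) ≤ j := by exact_mod_cast hj
  have hk : (0 : ℝ) ≤ k := Nat.cast_nonneg k
  apply one_div_le_one_div_of_le (by positivity)
  apply pow_le_pow_left₀ (by positivity); linarith

lemma TT_step (j : ℕ) (hj : 1 ≤ j) : TT j = 1 / (j : ℝ) ^ 2 + TT (j + 2) := by
  unfold TT
  rw [(TT_summable j hj).tsum_eq_zero_add]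
  congr 1
  · simp
  · refine tsum_congr fun k => ?_
    push_cast; ring

lemma TT_fin (j h : ℕ) (hj : 1 ≤ j) :
    ∑ i ∈ Finset.range h, 1 / ((j : ℝ) + 2 * i) ^ 2 = TT j - TT (j + 2 * h) := by
  induction h with
  | zero => simp
  | succ h ih =>
    rw [Finset.sum_range_succ, ih, TT_step (j + 2 * h) (by omega),
      show j + 2 * (h + 1) = j + 2 * h + 2 by ring]
    push_cast; ring

lemma TT_add (j : ℕ) (hj : 1 ≤ j) : TT j + TT (j + 1) = psi1 j := by
  have h := psi1_hasSum j hj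
  have h1 := TT_summable j hj
  have h2 := TT_summable (j + 1) (by omega)
  rw [← h.tsum_eq]
  rw [← tsum_even_add_odd (f := fun k : ℕ => 1 / ((j : ℝ) + k) ^ 2)]
  · unfold TT
    congr 1
    · refine tsum_congr fun k => ?_
      push_cast; ring
    · refine tsum_congr fun k => ?_
      push_cast; ring
  · convert h1 using 3; push_cast; ring
  · convert h2 using 3; push_cast; ring

lemma TT_even (j : ℕ) (hj : 1 ≤ j) : TT (2 * j) = psi1 j / 4 := by
  rw [← (psi1_hasSum j hj).tsum_eq, ← tsum_div_const]
  unfold TT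
  refine tsum_congr fun k => ?_
  push_cast
  rw [show (2 * (j : ℝ) + 2 * k) ^ 2 = ((j : ℝ) + k) ^ 2 * 4 by ring, div_mul_eq_div_div]

lemma TT_fin_rev (j h : ℕ) (hj : 1 ≤ j) :
    ∑ i ∈ Finset.range h, 1 / ((j : ℝ) + 2 * h - 2 - 2 * i) ^ 2 = TT j - TT (j + 2 * h) := by
  rw [← TT_fin j h hj, ← Finset.sum_range_reflect]
  refine Finset.sum_congr rfl fun i hi => ?_
  have := Finset.mem_range.mp hi
  rw [Nat.sub_sub, Nat.cast_sub (by omega)]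
  push_cast; ring_nf

/-- pieces for `a = 0` -/
lemma P0_eq (s : ℕ) (r : ℝ) (hr : r ^ 2 ≤ ((s : ℝ) + 3 / 2) ^ 2) (p q : ℕ) (hp : 1 ≤ p) (hq : 1 ≤ q)
    (hp' : (s : ℝ) + 5 / 2 - r = p) (hq' : (s : ℝ) + 5 / 2 + r = q) :
    4 * r * Ps s 0 r = TT p - TT q := by
  unfold Ps TT
  rw [← tsum_mul_left, ← Summable.tsum_sub (TT_summable p hp) (TT_summable q hq)]
  refine tsum_congr fun k => ?_
  have h1 : (p : ℝ) + 2 * k = Yk s k - r := by unfold Yk; linarith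
  have h2 : (q : ℝ) + 2 * k = Yk s k + r := by unfold Yk; linarith
  rw [h1, h2]
  unfold Pf
  rw [gP_zero]
  have := Ydiff_pos s k r hr
  have h3 : Yk s k - r ≠ 0 := by
    intro h; rw [sq_sub_sq, h] at this; simp at this
  have h4 : Yk s k + r ≠ 0 := by
    intro h; rw [sq_sub_sq, h] at this; simp at this
  rw [sq_sub_sq]
  generalize Yk s k = y at *
  field_simp
  ring

lemma Pt0_eq (s : ℕ) (r : ℝ) (hr : (s : ℝ) - 1 / 2 ≤ r) (p q : ℕ) (hp : 1 ≤ p) (hq : 1 ≤ q)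
    (hp' : r - ((s : ℝ) - 3 / 2) = p) (hq' : r + ((s : ℝ) - 3 / 2) = q + 2 * (s / 2 : ℕ) - 2) :
    4 * r * Pt s 0 r = TT p - TT (p + 2 * (s / 2)) - TT q + TT (q + 2 * (s / 2)) := by
  rw [sub_add, ← TT_fin _ _ hp, ← TT_fin_rev _ _ hq, ← Finset.sum_sub_distrib]
  unfold Pt
  rw [Finset.mul_sum]
  refine Finset.sum_congr rfl fun i hi => ?_
  have h1 : (p : ℝ) + 2 * i = r - Xi s i := by unfold Xi; linarith
  have h2 : (q : ℝ) + 2 * (s / 2 : ℕ) - 2 - 2 * i = r + Xi s i := by unfold Xi; linarith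
  rw [h1, h2]
  have := Xi_ne s i (Finset.mem_range.mp hi) r hr
  rw [gP_zero]
  have h3 : r - Xi s i ≠ 0 := by
    intro h; rw [sq_sub_sq, h] at this; simp at this
  have h4 : r + Xi s i ≠ 0 := by
    intro h; rw [sq_sub_sq, h] at this; simp at this
  rw [sq_sub_sq]
  generalize Xi s i = y at *
  field_simp
  ring

noncomputable def WW (s a : ℕ) (r : ℝ) : ℝ :=
  4 * r * (gP a r * Ps s a r - Pt s a r / gP a r)

lemma WW_M0 (s : ℕ) : WW s 0 ((s : ℝ) + 1 / 2) =
    3 / 2 * psi1 (s + 1) - 2 * psi1 (2 * s + 1) + 1 / (2 * (s : ℝ) + 1) ^ 2 := by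
  have hs : (0 : ℝ) ≤ s := Nat.cast_nonneg s
  have h1 := P0_eq s (s + 1 / 2) (by nlinarith) 2 (2 * s + 3) (by omega) (by omega)
    (by push_cast; ring) (by push_cast; ring)
  have h2 := Pt0_eq s (s + 1 / 2) (by linarith) 2 (2 * s + 1 - 2 * (s / 2)) (by omega) (by omega)
    (by push_cast; ring) (by rw [Nat.cast_sub (by omega)]; push_cast; ring)
  unfold WW
  rw [gP_zero, div_one, one_mul, mul_sub, h1, h2]
  have h3 : TT (2 + 2 * (s / 2)) + TT (2 * s + 1 - 2 * (s / 2)) = psi1 (s + 1) := by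
    rw [← TT_add (s + 1) (by omega)]
    rcases Nat.even_or_odd s with h | h
    · rw [show 2 + 2 * (s / 2) = s + 1 + 1 by grind, show 2 * s + 1 - 2 * (s / 2) = s + 1 by grind]
      ring
    · rw [show 2 + 2 * (s / 2) = s + 1 by grind, show 2 * s + 1 - 2 * (s / 2) = s + 1 + 1 by grind]
  rw [show 2 * s + 1 - 2 * (s / 2) + 2 * (s / 2) = 2 * s + 1 by omega]
  have h4 := TT_step (2 * s + 1) (by omega)
  have h5 := TT_add (2 * s + 1) (by omega)
  have h6 := TT_even (s + 1) (by omega)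
  rw [show 2 * s + 1 + 1 = 2 * (s + 1) by ring, h6] at h5
  rw [show 2 * s + 1 + 2 = 2 * s + 3 by ring] at h4
  push_cast at h4
  linear_combination h3 + h4 - 2 * h5

lemma WW_p0 (s : ℕ) : WW s 0 ((s : ℝ) + 3 / 2) =
    1 + 3 / 4 * psi1 (s + 2) - psi1 (s + 1) / 4 := by
  have hs : (0 : ℝ) ≤ s := Nat.cast_nonneg s
  have h1 := P0_eq s (s + 3 / 2) (by nlinarith) 1 (2 * s + 4) (by omega) (by omega)
    (by push_cast; ring) (by push_cast; ring)
  have h2 := Pt0_eq s (s + 3 / 2) (by linarith) 3 (2 * s + 2 - 2 * (s / 2)) (by omega) (by omega)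
    (by push_cast; ring) (by rw [Nat.cast_sub (by omega)]; push_cast; ring)
  unfold WW
  rw [gP_zero, div_one, one_mul, mul_sub, h1, h2]
  have h3 : TT (3 + 2 * (s / 2)) + TT (2 * s + 2 - 2 * (s / 2)) = psi1 (s + 2) := by
    rw [← TT_add (s + 2) (by omega)]
    rcases Nat.even_or_odd s with h | h
    · rw [show 3 + 2 * (s / 2) = s + 2 + 1 by grind, show 2 * s + 2 - 2 * (s / 2) = s + 2 by grind]
      ring
    · rw [show 3 + 2 * (s / 2) = s + 2 by grind, show 2 * s + 2 - 2 * (s / 2) = s + 2 + 1 by grind]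
  rw [show 2 * s + 2 - 2 * (s / 2) + 2 * (s / 2) = 2 * (s + 1) by omega]
  have h4 := TT_step 1 (by omega)
  have h5 := TT_even (s + 1) (by omega)
  have h6 := TT_even (s + 2) (by omega)
  rw [show 2 * s + 4 = 2 * (s + 2) by ring, h5, h6]
  push_cast at h4
  linear_combination h3 + h4

lemma WW_m0 (s : ℕ) (hs1 : 1 ≤ s) : WW s 0 ((s : ℝ) - 1 / 2) =
    -1 + 3 / 4 * psi1 s - psi1 (s + 1) / 4 := by
  have hs : (1 : ℝ) ≤ s := by exact_mod_cast hs1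
  have h1 := P0_eq s (s - 1 / 2) (by nlinarith) 3 (2 * s + 2) (by omega) (by omega)
    (by push_cast; ring) (by push_cast; ring)
  have h2 := Pt0_eq s (s - 1 / 2) (by linarith) 1 (2 * s - 2 * (s / 2)) (by omega) (by omega)
    (by push_cast; ring) (by rw [Nat.cast_sub (by omega)]; push_cast; ring)
  unfold WW
  rw [gP_zero, div_one, one_mul, mul_sub, h1, h2]
  have h3 : TT (1 + 2 * (s / 2)) + TT (2 * s - 2 * (s / 2)) = psi1 s := by
    rw [← TT_add s (by omega)]
    rcases Nat.even_or_odd s with h | h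
    · rw [show 1 + 2 * (s / 2) = s + 1 by grind, show 2 * s - 2 * (s / 2) = s by grind]
      ring
    · rw [show 1 + 2 * (s / 2) = s by grind, show 2 * s - 2 * (s / 2) = s + 1 by grind]
  rw [show 2 * s - 2 * (s / 2) + 2 * (s / 2) = 2 * s by omega]
  have h4 := TT_step 1 (by omega)
  have h5 := TT_even (s + 1) (by omega)
  have h6 := TT_even s (by omega)
  rw [show 2 * s + 2 = 2 * (s + 1) by ring, h5, h6]
  push_cast at h4
  linear_combination h3 - h4

end VA
end

section
open MeasureTheory Real Finset

namespace VA

noncomputable def qq (s a : ℕ) (r : ℝ) : ℝ := gP a r * Qs s a r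

lemma qq_step (s a : ℕ) (r : ℝ) (ha1 : 1 ≤ a) (ha : a ≤ s + 1)
    (hr : r ^ 2 ≤ ((s : ℝ) + 3 / 2) ^ 2) :
    qq s (a + 1) r = qq s a r - gP a r * sg s a := by
  unfold qq
  rw [Q_rec s a r ha1 ha hr, gP_succ]; ring

noncomputable def dl (s a : ℕ) (r : ℝ) : ℝ := qq s (a + 1) r - Qt s a r / gP a r

lemma dl_step (s a : ℕ) (r : ℝ) (ha : a ≤ s) (hr : r ^ 2 ≤ ((s : ℝ) + 3 / 2) ^ 2)
    (hr2 : (s : ℝ) - 1 / 2 ≤ r) (hg : gP (a + 1) r ≠ 0) :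
    dl s a r = dl s (a + 1) r + gP (a + 1) r * sg s (a + 1) - sgt s a / gP (a + 1) r := by
  unfold dl
  rw [qq_step s (a + 1) r (by omega) (by omega) hr, Qt_rec s a r (fun i hi => Xi_ne s i hi r hr2)]
  have h := hg
  rw [gP_succ] at h
  have h1 := left_ne_zero_of_mul h
  have h2 := right_ne_zero_of_mul h
  have e : Qt s a r / gP a r = (r ^ 2 - ((a : ℝ) + 1 / 2) ^ 2) * Qt s a r / gP (a + 1) r := by
    rw [gP_succ, mul_comm (gP a r), mul_div_mul_left _ _ h2]
  rw [e, sub_div]; ring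

lemma WW_step (s a : ℕ) (r : ℝ) (ha : a ≤ s) (hr : r ^ 2 ≤ ((s : ℝ) + 3 / 2) ^ 2)
    (hr2 : (s : ℝ) - 1 / 2 ≤ r) (hg : gP (a + 1) r ≠ 0) :
    WW s (a + 1) r = WW s a r - 4 * r * dl s a r / (r ^ 2 - ((a : ℝ) + 1 / 2) ^ 2) := by
  unfold WW dl qq
  rw [P_rec s a r (by omega) hr, Pt_rec s a r (fun i hi => Xi_ne s i hi r hr2)]
  have h := hg
  rw [gP_succ] at h ⊢
  have h1 := left_ne_zero_of_mul h
  have h2 := right_ne_zero_of_mul h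
  generalize r ^ 2 - ((a : ℝ) + 1 / 2) ^ 2 = e at *
  field_simp
  ring

lemma g35 (s a : ℕ) : gP a ((s : ℝ) + 5 / 2) * ((s : ℝ) - a + 2) =
    gP a ((s : ℝ) + 3 / 2) * ((s : ℝ) + a + 2) := by
  have := gP_shift a ((s : ℝ) + 3 / 2)
  rw [show (s : ℝ) + 3 / 2 + 1 = s + 5 / 2 by ring] at this
  linear_combination this

lemma g13 (s a : ℕ) : gP a ((s : ℝ) + 3 / 2) * ((s : ℝ) - a + 1) =
    gP a ((s : ℝ) + 1 / 2) * ((s : ℝ) + a + 1) := by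
  have := gP_shift a ((s : ℝ) + 1 / 2)
  rw [show (s : ℝ) + 1 / 2 + 1 = s + 3 / 2 by ring] at this
  linear_combination this

lemma gm1 (s a : ℕ) : gP a ((s : ℝ) + 1 / 2) * ((s : ℝ) - a) =
    gP a ((s : ℝ) - 1 / 2) * ((s : ℝ) + a) := by
  have := gP_shift a ((s : ℝ) - 1 / 2)
  rw [show (s : ℝ) - 1 / 2 + 1 = s + 1 / 2 by ring] at this
  linear_combination this

lemma inc_p (s a : ℕ) (ha1 : 1 ≤ a) (ha : a ≤ s + 1) :
    gP a ((s : ℝ) + 3 / 2) * sg s a = 1 / (4 * a) := by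
  have hA : (a : ℝ) ≤ s + 1 := by exact_mod_cast ha
  have hA1 : (1 : ℝ) ≤ a := by exact_mod_cast ha1
  have h := g35 s a
  have h5 := gP_pos a ((s : ℝ) + 5 / 2) (by linarith)
  have h3 : 0 < (s : ℝ) - a + 2 := by linarith
  unfold sg
  rw [mul_assoc (4 * (a : ℝ)), h]
  have h6 := gP_pos a ((s : ℝ) + 3 / 2) (by linarith)
  have h7 : 0 < (s : ℝ) + a + 2 := by positivity
  generalize gP a ((s : ℝ) + 3 / 2) = G at *
  field_simp

lemma inc_M (s a : ℕ) (ha1 : 1 ≤ a) (ha : a ≤ s) :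
    gP a ((s : ℝ) + 1 / 2) * sg s a = ((s : ℝ) - a + 1) / (4 * a * ((s : ℝ) + a + 1)) := by
  have hA : (a : ℝ) ≤ s := by exact_mod_cast ha
  have hA1 : (1 : ℝ) ≤ a := by exact_mod_cast ha1
  have h := inc_p s a ha1 (by omega)
  have h2 := g13 s a
  have h3 : 0 < (s : ℝ) + a + 1 := by positivity
  rw [eq_div_iff (by positivity)]
  rw [eq_div_iff (by positivity)] at h
  linear_combination (s - a + 1 : ℝ) * h - sg s a * 4 * a * h2

lemma inc_m (s a : ℕ) (ha1 : 1 ≤ a) (ha : a ≤ s) :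
    gP a ((s : ℝ) - 1 / 2) * sg s a =
      ((s : ℝ) - a) * ((s : ℝ) - a + 1) / (4 * a * ((s : ℝ) + a) * ((s : ℝ) + a + 1)) := by
  have hA : (a : ℝ) ≤ s := by exact_mod_cast ha
  have hA1 : (1 : ℝ) ≤ a := by exact_mod_cast ha1
  have h := inc_M s a ha1 (by omega)
  have h2 := gm1 s a
  have h3 : 0 < (s : ℝ) + a + 1 := by positivity
  have h4 : 0 < (s : ℝ) + a := by positivity
  rw [eq_div_iff (by positivity)]
  rw [eq_div_iff (by positivity)] at h
  linear_combination (s - a : ℝ) * h - sg s a * 4 * a * (s + a + 1) * h2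

lemma e_M (s a : ℕ) : ((s : ℝ) + 1 / 2) ^ 2 - ((a : ℝ) + 1 / 2) ^ 2 = ((s : ℝ) - a) * (s + a + 1) := by
  ring
lemma e_p (s a : ℕ) : ((s : ℝ) + 3 / 2) ^ 2 - ((a : ℝ) + 1 / 2) ^ 2 = ((s : ℝ) - a + 1) * (s + a + 2) := by
  ring
lemma e_m (s a : ℕ) : ((s : ℝ) - 1 / 2) ^ 2 - ((a : ℝ) + 1 / 2) ^ 2 = ((s : ℝ) - a - 1) * (s + a) := by
  ring

lemma inn_M (s a : ℕ) (ha : a < s) :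
    sgt s a / gP (a + 1) ((s : ℝ) + 1 / 2) =
      ((s : ℝ) - a - 1) / (4 * (a + 1) * ((s : ℝ) + a + 1)) := by
  have hA : (a : ℝ) + 1 ≤ s := by exact_mod_cast ha
  have h1 := gP_pos a ((s : ℝ) + 1 / 2) (by linarith)
  rw [gP_succ, e_M]
  unfold sgt
  have h2 : (s : ℝ) - a ≠ 0 := by linarith
  have h3 : (s : ℝ) + a + 1 ≠ 0 := by positivity
  generalize gP a ((s : ℝ) + 1 / 2) = G at *
  field_simp

lemma inn_p (s a : ℕ) (ha : a < s) :
    sgt s a / gP (a + 1) ((s : ℝ) + 3 / 2) =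
      ((s : ℝ) - a) * ((s : ℝ) - a - 1) / (4 * (a + 1) * ((s : ℝ) + a + 1) * ((s : ℝ) + a + 2)) := by
  have hA : (a : ℝ) + 1 ≤ s := by exact_mod_cast ha
  have h1 := gP_pos a ((s : ℝ) + 1 / 2) (by linarith)
  rw [gP_succ, e_p, ← mul_assoc, g13]
  unfold sgt
  have h2 : (s : ℝ) - a ≠ 0 := by linarith
  have h3 : (s : ℝ) + a + 1 ≠ 0 := by positivity
  have h4 : (s : ℝ) + a + 2 ≠ 0 := by positivity
  generalize gP a ((s : ℝ) + 1 / 2) = G at *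
  field_simp

lemma inn_m (s a : ℕ) (ha : a + 1 < s) :
    sgt s a / gP (a + 1) ((s : ℝ) - 1 / 2) = 1 / (4 * (a + 1)) := by
  have hA : (a : ℝ) + 1 + 1 ≤ s := by exact_mod_cast ha
  have h1 := gP_pos a ((s : ℝ) + 1 / 2) (by linarith)
  rw [gP_succ, e_m, mul_comm ((s : ℝ) - a - 1), ← mul_assoc, ← gm1]
  unfold sgt
  have h2 : (s : ℝ) - a ≠ 0 := by linarith
  have h3 : (s : ℝ) - a - 1 ≠ 0 := by linarith
  generalize gP a ((s : ℝ) + 1 / 2) = G at *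
  field_simp

lemma rb_M (s : ℕ) : ((s : ℝ) + 1 / 2) ^ 2 ≤ ((s : ℝ) + 3 / 2) ^ 2 := by
  have hs : (0 : ℝ) ≤ s := Nat.cast_nonneg s
  nlinarith
lemma rb_m (s : ℕ) : ((s : ℝ) - 1 / 2) ^ 2 ≤ ((s : ℝ) + 3 / 2) ^ 2 := by
  have hs : (0 : ℝ) ≤ s := Nat.cast_nonneg s
  nlinarith

lemma dl_M (s d : ℕ) : ∀ a, a + d = s → dl s a ((s : ℝ) + 1 / 2) =
    ((s : ℝ) - a) / (2 * (2 * s + 1) * ((s : ℝ) + a + 1)) := by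
  induction d with
  | zero =>
    intro a ha
    obtain rfl : a = s := by omega
    unfold dl qq
    rw [gP_eq_zero (a + 1) a (by omega), Qt_zero a a _ (by omega)]; simp
  | succ d ih =>
    intro a ha
    have hA : (a : ℝ) + 1 ≤ s := by exact_mod_cast (by omega : a + 1 ≤ s)
    rw [dl_step s a _ (by omega) (rb_M s) (by linarith)
      (gP_pos _ _ (by push_cast; linarith)).ne', ih (a + 1) (by omega), inc_M _ _ (by omega) (by omega),
      inn_M s a (by omega)]
    push_cast
    have h1 : (s : ℝ) + a + 1 ≠ 0 := by positivity
    have h2 : (s : ℝ) + (a + 1) + 1 ≠ 0 := by positivity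
    field_simp
    ring

lemma dl_p (s d : ℕ) : ∀ a, a + d = s → dl s a ((s : ℝ) + 3 / 2) =
    (2 * s + 1) * ((s : ℝ) - a + 1) / (4 * (s + 1) * ((s : ℝ) + a + 1)) := by
  induction d with
  | zero =>
    intro a ha
    obtain rfl : a = s := by omega
    have h := qq_step a (a + 1) ((a : ℝ) + 3 / 2) (by omega) (by omega) le_rfl
    have h0 : qq a (a + 1 + 1) ((a : ℝ) + 3 / 2) = 0 := by
      unfold qq
      rw [gP_eq_zero' (a + 1 + 1) (a + 1) (by omega) _ (by push_cast; ring)]; simp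
    rw [h0, inc_p a (a + 1) (by omega) (by omega)] at h
    unfold dl
    rw [Qt_zero a a _ (by omega)]
    rw [show qq a (a + 1) ((a : ℝ) + 3 / 2) = 1 / (4 * ((a + 1 : ℕ) : ℝ)) by linarith]
    push_cast
    have h1 : (a : ℝ) + a + 1 ≠ 0 := by positivity
    field_simp
    ring
  | succ d ih =>
    intro a ha
    have hA : (a : ℝ) + 1 ≤ s := by exact_mod_cast (by omega : a + 1 ≤ s)
    rw [dl_step s a _ (by omega) le_rfl (by linarith)
      (gP_pos _ _ (by push_cast; linarith)).ne', ih (a + 1) (by omega), inc_p _ _ (by omega) (by omega),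
      inn_p s a (by omega)]
    push_cast
    have h1 : (s : ℝ) + a + 1 ≠ 0 := by positivity
    have h3 : (s : ℝ) + a + 2 ≠ 0 := by positivity
    rw [show (s : ℝ) + (a + 1) + 1 = s + a + 2 by ring]
    field_simp
    ring

lemma dl_m (s d : ℕ) : ∀ a, a + 1 + d = s → dl s a ((s : ℝ) - 1 / 2) =
    -(2 * s + 1) * ((s : ℝ) - a - 1) / (4 * s * ((s : ℝ) + a + 1)) := by
  induction d with
  | zero =>
    intro a ha
    obtain rfl : a + 1 = s := by omega
    unfold dl qq
    rw [gP_eq_zero' (a + 1) a (by omega) _ (by push_cast; ring), Qt_zero _ a _ (by omega)]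
    push_cast; simp
  | succ d ih =>
    intro a ha
    have hA : (a : ℝ) + 1 + 1 ≤ s := by exact_mod_cast (by omega : a + 1 + 1 ≤ s)
    rw [dl_step s a _ (by omega) (rb_m s) (by linarith)
      (gP_pos _ _ (by push_cast; linarith)).ne', ih (a + 1) (by omega), inc_m _ _ (by omega) (by omega),
      inn_m s a (by omega)]
    push_cast
    have h1 : (s : ℝ) + a + 1 ≠ 0 := by positivity
    have h3 : (s : ℝ) + a + 2 ≠ 0 := by positivity
    have h4 : (s : ℝ) ≠ 0 := by
      have := Nat.cast_nonneg (α := ℝ) a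
      intro h; linarith
    rw [show (s : ℝ) + (a + 1) = s + a + 1 by ring, show (s : ℝ) + a + 1 + 1 = s + a + 2 by ring]
    field_simp
    ring

/-- the difference of the two outer shifted sums -/
lemma qq_diff (s d : ℕ) : ∀ a, a + d = s + 1 → 1 ≤ a →
    qq s a ((s : ℝ) + 3 / 2) - qq s a ((s : ℝ) - 1 / 2) =
      (2 * s + 1) / (2 * ((s : ℝ) + a)) - (2 * s + 1) / (4 * ((s : ℝ) + 1)) := by
  induction d with
  | zero =>
    intro a ha ha1
    obtain rfl : a = s + 1 := by omega
    have h := qq_step s (s + 1) ((s : ℝ) + 3 / 2) (by omega) (by omega) le_rfl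
    have h0 : qq s (s + 1 + 1) ((s : ℝ) + 3 / 2) = 0 := by
      unfold qq
      rw [gP_eq_zero' (s + 1 + 1) (s + 1) (by omega) _ (by push_cast; ring)]; simp
    rw [h0, inc_p s (s + 1) (by omega) (by omega)] at h
    rw [show qq s (s + 1) ((s : ℝ) + 3 / 2) = 1 / (4 * ((s + 1 : ℕ) : ℝ)) by linarith]
    have h2 : qq s (s + 1) ((s : ℝ) - 1 / 2) = 0 := by
      unfold qq
      cases s with
      | zero =>
        rw [show gP (0 + 1) (((0 : ℕ) : ℝ) - 1 / 2) = 0 by rw [gP_succ]; norm_num]; simp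
      | succ s =>
        rw [gP_eq_zero' (s + 1 + 1) s (by omega) _ (by push_cast; ring)]; simp
    rw [h2]
    push_cast
    have h1 : (s : ℝ) + (s + 1) ≠ 0 := by positivity
    field_simp
    ring
  | succ d ih =>
    intro a ha ha1
    have h := ih (a + 1) (by omega) (by omega)
    rw [qq_step s a _ ha1 (by omega) le_rfl, qq_step s a _ ha1 (by omega) (rb_m s),
      inc_p s a ha1 (by omega), inc_m s a ha1 (by omega)] at h
    have hA1 : (1 : ℝ) ≤ a := by exact_mod_cast ha1
    push_cast at h
    have e : qq s a ((s : ℝ) + 3 / 2) - qq s a ((s : ℝ) - 1 / 2) =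
      (2 * s + 1) / (2 * ((s : ℝ) + (a + 1))) - (2 * s + 1) / (4 * ((s : ℝ) + 1)) + (1 / (4 * (a : ℝ))
       - ((s : ℝ) - a) * ((s : ℝ) - a + 1) / (4 * a * ((s : ℝ) + a) * ((s : ℝ) + a + 1))) := by
      linear_combination h
    rw [e]
    have h1 : (s : ℝ) + a ≠ 0 := by positivity
    have h2 : (s : ℝ) + a + 1 ≠ 0 := by positivity
    rw [← add_assoc (s : ℝ)]
    field_simp
    ring

lemma WW_M (s : ℕ) : ∀ a, a ≤ s → WW s a ((s : ℝ) + 1 / 2) =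
    psi1 (s + a + 1) + psi1 (s + 1) / 2 - 2 * psi1 (2 * s + 1) + 1 / (2 * (s : ℝ) + 1) ^ 2 := by
  intro a
  induction a with
  | zero => intro _; rw [WW_M0]; ring_nf
  | succ a ih =>
    intro ha
    have hA : (a : ℝ) + 1 ≤ s := by exact_mod_cast ha
    rw [WW_step s a _ (by omega) (rb_M s) (by linarith) (gP_pos _ _ (by push_cast; linarith)).ne',
      ih (by omega), dl_M s (s - a) a (by omega), e_M]
    rw [show s + (a + 1) + 1 = s + a + 1 + 1 by ring, psi1_succ (s + a + 1) (by omega)]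
    push_cast
    have h1 : (s : ℝ) - a ≠ 0 := by linarith
    have h2 : (s : ℝ) + a + 1 ≠ 0 := by positivity
    have : 4 * ((s : ℝ) + 1 / 2) * (((s : ℝ) - a) / (2 * (2 * s + 1) * ((s : ℝ) + a + 1))) / (((s : ℝ) - a) * (s + a + 1)) = 1 / ((s : ℝ) + a + 1) ^ 2 := by
      field_simp
      ring
    rw [this]; ring

lemma WW_p (s : ℕ) : ∀ a, a ≤ s → WW s a ((s : ℝ) + 3 / 2) =
    (2 * s + 1) * (2 * s + 3) / (2 * (s + 1) * ((s : ℝ) + a + 1)) + psi1 (s + 1) / 2 - 1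
      - 1 / (4 * ((s : ℝ) + 1) ^ 2) := by
  intro a
  induction a with
  | zero =>
    intro _; rw [WW_p0, psi1_succ (s + 1) (by omega)]
    have h2 : (s : ℝ) + 1 ≠ 0 := by positivity
    push_cast
    rw [add_zero]
    field_simp
    ring
  | succ a ih =>
    intro ha
    have hA : (a : ℝ) + 1 ≤ s := by exact_mod_cast ha
    rw [WW_step s a _ (by omega) le_rfl (by linarith) (gP_pos _ _ (by push_cast; linarith)).ne',
      ih (by omega), dl_p s (s - a) a (by omega), e_p]
    push_cast
    have h1 : (s : ℝ) - a + 1 ≠ 0 := by linarith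
    have h2 : (s : ℝ) + a + 1 ≠ 0 := by positivity
    have h3 : (s : ℝ) + a + 2 ≠ 0 := by positivity
    rw [show (s : ℝ) + (a + 1) + 1 = s + a + 2 by ring]
    field_simp
    ring

lemma WW_m (s : ℕ) : ∀ a, a + 1 ≤ s → WW s a ((s : ℝ) - 1 / 2) =
    -((2 * s + 1) * (2 * s - 1)) / (2 * s * ((s : ℝ) + a)) + psi1 (s + 1) / 2 + 1
      + 1 / (4 * (s : ℝ) ^ 2) := by
  intro a
  induction a with
  | zero =>
    intro hs1; rw [WW_m0 s hs1]
    have hs : (1 : ℝ) ≤ s := by exact_mod_cast hs1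
    rw [psi1_succ s (by omega)]
    push_cast
    rw [add_zero]
    field_simp
    ring
  | succ a ih =>
    intro ha
    have hA : (a : ℝ) + 1 + 1 ≤ s := by exact_mod_cast ha
    have ha0 : (0 : ℝ) ≤ a := Nat.cast_nonneg a
    rw [WW_step s a _ (by omega) (rb_m s) (by linarith) (gP_pos _ _ (by push_cast; linarith)).ne',
      ih (by omega), dl_m s (s - 1 - a) a (by omega), e_m]
    push_cast
    have h0 : 0 < (s : ℝ) := by linarith
    have h1 : (s : ℝ) - a - 1 ≠ 0 := by linarith
    have h2 : (s : ℝ) + a ≠ 0 := by positivity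
    have h3 : (s : ℝ) + a + 1 ≠ 0 := by positivity
    rw [show (s : ℝ) + (a + 1) = s + a + 1 by ring]
    field_simp
    ring

end VA
end

section
open MeasureTheory Real Finset

namespace VA

noncomputable def Rf (a : ℕ) (x y : ℝ) : ℝ :=
  (1 - 2 * (1 + a) * y ^ 2 - 2 * (1 - a) * x ^ 2) /
    ((y ^ 2 - x ^ 2) * ((y - x) ^ 2 - 1) * ((y + x) ^ 2 - 1))

noncomputable def Fa (a : ℕ) (x y : ℝ) : ℝ := 4 * x * y * (gP a x / gP a y) * Rf a x y ^ 2

/-- abstract partial fractions, `S = 2 s + 1`, `b = a`, `t = y² - M²` -/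
lemma pf_sq (s a t tp tm : ℝ) (hs : s ≠ 0) (hs1 : s + 1 ≠ 0) (hM : 2 * s + 1 ≠ 0)
    (h0 : t ≠ 0) (hp : tp ≠ 0) (hm : tm ≠ 0) (ep : tp = t - 2 * (s + 1)) (em : tm = t + 2 * s) :
    (1 / t - (s + 1 + a) / (2 * s + 1) / tp - (s - a) / (2 * s + 1) / tm) ^ 2 =
      1 / t ^ 2 + ((s + 1 + a) / (2 * s + 1)) ^ 2 / tp ^ 2 + ((s - a) / (2 * s + 1)) ^ 2 / tm ^ 2
      + a / (s * (s + 1)) / t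
      + (-((s + 1 + a) / (2 * s + 1)) / (s + 1)
          + (s + 1 + a) * (s - a) / (2 * s + 1) ^ 3) / tp
      + (((s - a) / (2 * s + 1)) / s - (s + 1 + a) * (s - a) / (2 * s + 1) ^ 3) / tm := by
  have e1 : 1 / (t * tp) = (1 / tp - 1 / t) / (2 * (s + 1)) := by
    have : 2 * (s + 1) = t - tp := by rw [ep]; ring
    rw [div_sub_div _ _ hp h0, this]
    have : t - tp ≠ 0 := by rw [← this]; simpa using hs1
    field_simp
  have e2 : 1 / (t * tm) = (1 / t - 1 / tm) / (2 * s) := by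
    have : 2 * s = tm - t := by rw [em]; ring
    rw [div_sub_div _ _ h0 hm, this]
    have : tm - t ≠ 0 := by rw [← this]; simpa using hs
    field_simp
  have e3 : 1 / (tp * tm) = (1 / tp - 1 / tm) / (2 * (2 * s + 1)) := by
    have : 2 * (2 * s + 1) = tm - tp := by rw [em, ep]; ring
    rw [div_sub_div _ _ hp hm, this]
    have : tm - tp ≠ 0 := by rw [← this]; simpa using hM
    field_simp
  have key : (1 / t - (s + 1 + a) / (2 * s + 1) / tp - (s - a) / (2 * s + 1) / tm) ^ 2 =
      1 / t ^ 2 + ((s + 1 + a) / (2 * s + 1)) ^ 2 / tp ^ 2 + ((s - a) / (2 * s + 1)) ^ 2 / tm ^ 2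
      - 2 * ((s + 1 + a) / (2 * s + 1)) * (1 / (t * tp)) - 2 * ((s - a) / (2 * s + 1)) * (1 / (t * tm))
      + 2 * ((s + 1 + a) / (2 * s + 1)) * ((s - a) / (2 * s + 1)) * (1 / (tp * tm)) := by
    ring
  rw [key, e1, e2, e3]
  clear e1 e2 e3 key ep em
  have hM' : s * 2 + 1 ≠ 0 := by rwa [mul_comm]
  field_simp
  ring

lemma pf_R (s a t tp tm : ℝ) (hM : 2 * s + 1 ≠ 0)
    (h0 : t ≠ 0) (hp : tp ≠ 0) (hm : tm ≠ 0) (ep : tp = t - 2 * (s + 1)) (em : tm = t + 2 * s) :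
    1 / t - (s + 1 + a) / (2 * s + 1) / tp - (s - a) / (2 * s + 1) / tm =
      (-2 * (1 + a) * t - 4 * s * (s + 1)) / (t * (tp * tm)) := by
  rw [div_sub_div _ _ h0 hp, div_sub_div _ _ (mul_ne_zero h0 hp) hm, div_eq_div_iff
    (mul_ne_zero (mul_ne_zero h0 hp) hm) (mul_ne_zero h0 (mul_ne_zero hp hm))]
  have hM' : s * 2 + 1 ≠ 0 := by rwa [mul_comm]
  field_simp
  rw [ep, em]; ring

lemma hasSum_ext {f g : ℕ → ℝ} {c : ℝ} (h : HasSum f c) (e : ∀ k, g k = f k) : HasSum g c := by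
  have : g = f := funext e
  rw [this]; exact h

noncomputable def kp (s a : ℝ) : ℝ := (s + 1 + a) / (2 * s + 1)
noncomputable def km (s a : ℝ) : ℝ := (s - a) / (2 * s + 1)
noncomputable def b0 (s a : ℝ) : ℝ := a / (s * (s + 1))
noncomputable def bp (s a : ℝ) : ℝ :=
  -((s + 1 + a) / (2 * s + 1)) / (s + 1) + (s + 1 + a) * (s - a) / (2 * s + 1) ^ 3
noncomputable def bm (s a : ℝ) : ℝ :=
  ((s - a) / (2 * s + 1)) / s - (s + 1 + a) * (s - a) / (2 * s + 1) ^ 3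

lemma b_sum (s a : ℝ) (hs : 0 < s) : b0 s a + bp s a + bm s a = 0 := by
  unfold b0 bp bm
  have h : s * 2 + 1 ≠ 0 := by positivity
  field_simp
  ring

lemma Rf_sq (s : ℝ) (a : ℕ) (y : ℝ) (hs : 0 < s) (h0 : y ^ 2 - (s + 1 / 2) ^ 2 ≠ 0)
    (hp : y ^ 2 - (s + 3 / 2) ^ 2 ≠ 0) (hm : y ^ 2 - (s - 1 / 2) ^ 2 ≠ 0) :
    Rf a (s + 1 / 2) y ^ 2 =
      1 / (y ^ 2 - (s + 1 / 2) ^ 2) ^ 2 + kp s a ^ 2 / (y ^ 2 - (s + 3 / 2) ^ 2) ^ 2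
      + km s a ^ 2 / (y ^ 2 - (s - 1 / 2) ^ 2) ^ 2 + b0 s a / (y ^ 2 - (s + 1 / 2) ^ 2)
      + bp s a / (y ^ 2 - (s + 3 / 2) ^ 2) + bm s a / (y ^ 2 - (s - 1 / 2) ^ 2) := by
  have e := pf_sq s a _ _ _ hs.ne' (by positivity) (by positivity) h0 hp hm (by ring) (by ring)
  have e2 := pf_R s a _ _ _ (by positivity) h0 hp hm (by ring) (by ring)
  unfold kp km b0 bp bm
  rw [← e, e2]
  unfold Rf
  congr 2
  · ring
  · ring

lemma Rf_sq' (s : ℝ) (a : ℕ) (x : ℝ) (hs : 0 < s) (h0 : (s + 1 / 2) ^ 2 - x ^ 2 ≠ 0)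
    (hp : (s + 3 / 2) ^ 2 - x ^ 2 ≠ 0) (hm : (s - 1 / 2) ^ 2 - x ^ 2 ≠ 0) :
    Rf a x (s + 1 / 2) ^ 2 =
      1 / ((s + 1 / 2) ^ 2 - x ^ 2) ^ 2 + kp s (-a) ^ 2 / ((s + 3 / 2) ^ 2 - x ^ 2) ^ 2
      + km s (-a) ^ 2 / ((s - 1 / 2) ^ 2 - x ^ 2) ^ 2 - b0 s (-a) / ((s + 1 / 2) ^ 2 - x ^ 2)
      - bp s (-a) / ((s + 3 / 2) ^ 2 - x ^ 2) - bm s (-a) / ((s - 1 / 2) ^ 2 - x ^ 2) := by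
  have e := pf_sq s (-a) (-((s + 1 / 2) ^ 2 - x ^ 2)) (-((s + 3 / 2) ^ 2 - x ^ 2))
    (-((s - 1 / 2) ^ 2 - x ^ 2)) hs.ne' (by positivity) (by positivity) (neg_ne_zero.mpr h0)
    (neg_ne_zero.mpr hp) (neg_ne_zero.mpr hm) (by ring) (by ring)
  have e2 := pf_R s (-a) (-((s + 1 / 2) ^ 2 - x ^ 2)) (-((s + 3 / 2) ^ 2 - x ^ 2))
    (-((s - 1 / 2) ^ 2 - x ^ 2)) (by positivity) (neg_ne_zero.mpr h0)
    (neg_ne_zero.mpr hp) (neg_ne_zero.mpr hm) (by ring) (by ring)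
  have e3 : Rf a x (s + 1 / 2) ^ 2 = ((-2 * (1 + -(a : ℝ)) * -((s + 1 / 2) ^ 2 - x ^ 2) - 4 * s * (s + 1)) /
    (-((s + 1 / 2) ^ 2 - x ^ 2) * (-((s + 3 / 2) ^ 2 - x ^ 2) * -((s - 1 / 2) ^ 2 - x ^ 2)))) ^ 2 := by
    unfold Rf
    rw [← neg_sq, ← div_neg]
    congr 2
    · ring
    · ring
  rw [e3, ← e2, e]
  unfold kp km b0 bp bm
  simp only [neg_sq, div_neg, sub_eq_add_neg]

lemma Q_shift (a : ℕ) (y r : ℝ) (h : y ^ 2 - r ^ 2 ≠ 0) (hg : gP (a + 1) y ≠ 0) :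
    y / gP a y / (y ^ 2 - r ^ 2) =
      (r ^ 2 - ((a : ℝ) + 1 / 2) ^ 2) * (y / (gP (a + 1) y * (y ^ 2 - r ^ 2))) + y / gP (a + 1) y := by
  rw [gP_succ] at hg ⊢
  have h1 := left_ne_zero_of_mul hg
  have h2 := right_ne_zero_of_mul hg
  generalize ((a : ℝ) + 1 / 2) ^ 2 = e at *
  field_simp
  ring

lemma outer_hasSum (s a : ℕ) (hs : 1 ≤ s) (ha : a ≤ s) :
    HasSum (fun k => Fa a ((s : ℝ) + 1 / 2) (Yk s k))
      (4 * ((s : ℝ) + 1 / 2) * gP a ((s : ℝ) + 1 / 2) *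
        (Ps s a ((s : ℝ) + 1 / 2) + kp s a ^ 2 * Ps s a ((s : ℝ) + 3 / 2)
          + km s a ^ 2 * Ps s a ((s : ℝ) - 1 / 2)
          + b0 s a * ((((s : ℝ) + 1 / 2) ^ 2 - ((a : ℝ) + 1 / 2) ^ 2) * Qs s (a + 1) ((s : ℝ) + 1 / 2))
          + bp s a * ((((s : ℝ) + 3 / 2) ^ 2 - ((a : ℝ) + 1 / 2) ^ 2) * Qs s (a + 1) ((s : ℝ) + 3 / 2))
          + bm s a * ((((s : ℝ) - 1 / 2) ^ 2 - ((a : ℝ) + 1 / 2) ^ 2) * Qs s (a + 1) ((s : ℝ) - 1 / 2)))) := by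
  have hP := fun r (hr : r ^ 2 ≤ ((s : ℝ) + 3 / 2) ^ 2) => (Pf_summable s a r (by omega) hr).hasSum
  have hQ := fun r (hr : r ^ 2 ≤ ((s : ℝ) + 3 / 2) ^ 2) =>
    (Qf_summable s (a + 1) r (by omega) (by omega) hr).hasSum
  have hs' : (0 : ℝ) < s := by exact_mod_cast hs
  have H := (((((hP _ (rb_M s)).add ((hP _ le_rfl).mul_left (kp s a ^ 2))).add
    ((hP _ (rb_m s)).mul_left (km s a ^ 2))).add
    (((hQ _ (rb_M s)).mul_left (((s : ℝ) + 1 / 2) ^ 2 - ((a : ℝ) + 1 / 2) ^ 2)).mul_left (b0 s a))).add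
    (((hQ _ le_rfl).mul_left (((s : ℝ) + 3 / 2) ^ 2 - ((a : ℝ) + 1 / 2) ^ 2)).mul_left (bp s a))).add
    (((hQ _ (rb_m s)).mul_left (((s : ℝ) - 1 / 2) ^ 2 - ((a : ℝ) + 1 / 2) ^ 2)).mul_left (bm s a))
  have H2 := H.mul_left (4 * ((s : ℝ) + 1 / 2) * gP a ((s : ℝ) + 1 / 2))
  refine hasSum_ext H2 fun k => ?_
  have t0 := (Ydiff_pos s k _ (rb_M s)).ne'
  have tp := (Ydiff_pos s k ((s : ℝ) + 3 / 2) le_rfl).ne'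
  have tm := (Ydiff_pos s k _ (rb_m s)).ne'
  have hg := (gY_pos s (a + 1) k (by omega)).ne'
  have q0 := Q_shift a _ _ t0 hg
  have qp := Q_shift a _ _ tp hg
  have qm := Q_shift a _ _ tm hg
  have hb := b_sum s a hs'
  unfold Fa Pf Qf
  rw [Rf_sq s a _ hs' t0 tp tm]
  generalize Yk s k ^ 2 - ((s : ℝ) + 1 / 2) ^ 2 = u0 at *
  generalize Yk s k ^ 2 - ((s : ℝ) + 3 / 2) ^ 2 = up at *
  generalize Yk s k ^ 2 - ((s : ℝ) - 1 / 2) ^ 2 = um at *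
  generalize ((s : ℝ) + 1 / 2) ^ 2 - ((a : ℝ) + 1 / 2) ^ 2 = e0 at *
  generalize ((s : ℝ) + 3 / 2) ^ 2 - ((a : ℝ) + 1 / 2) ^ 2 = ep at *
  generalize ((s : ℝ) - 1 / 2) ^ 2 - ((a : ℝ) + 1 / 2) ^ 2 = em at *
  generalize gP a ((s : ℝ) + 1 / 2) = G at *
  generalize (s : ℝ) + 1 / 2 = M at *
  linear_combination 4 * M * G * (b0 s a * q0 + bp s a * qp + bm s a * qm
    + (Yk s k / gP (a + 1) (Yk s k)) * hb)

/-- the case `m = 0` -/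
lemma outer_hasSum0 (s : ℕ) :
    HasSum (fun k => Fa s ((s : ℝ) + 1 / 2) (Yk s k))
      (4 * ((s : ℝ) + 1 / 2) * gP s ((s : ℝ) + 1 / 2) *
        (Ps s s ((s : ℝ) + 1 / 2) + Ps s s ((s : ℝ) + 3 / 2) - 2 * Qs s (s + 1) ((s : ℝ) + 3 / 2))) := by
  have hP := fun r (hr : r ^ 2 ≤ ((s : ℝ) + 3 / 2) ^ 2) => (Pf_summable s s r (by omega) hr).hasSum
  have hQ := fun r (hr : r ^ 2 ≤ ((s : ℝ) + 3 / 2) ^ 2) =>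
    (Qf_summable s (s + 1) r (by omega) (by omega) hr).hasSum
  have hs' : (0 : ℝ) ≤ s := Nat.cast_nonneg s
  have H := ((hP _ (rb_M s)).add (hP _ le_rfl)).sub ((hQ _ le_rfl).mul_left 2)
  have H2 := H.mul_left (4 * ((s : ℝ) + 1 / 2) * gP s ((s : ℝ) + 1 / 2))
  refine hasSum_ext H2 fun k => ?_
  have t0 := (Ydiff_pos s k _ (rb_M s)).ne'
  have tp := (Ydiff_pos s k ((s : ℝ) + 3 / 2) le_rfl).ne'
  have tm := (Ydiff_pos s k _ (rb_m s)).ne'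
  have hg := (gY_pos s s k (by omega)).ne'
  have e := pf_R s s _ _ _ (by positivity) t0 tp tm (by ring) (by ring)
  have e3 : Rf s (s + 1 / 2) (Yk s k) = 1 / (Yk s k ^ 2 - ((s : ℝ) + 1 / 2) ^ 2)
      - 1 / (Yk s k ^ 2 - ((s : ℝ) + 3 / 2) ^ 2) := by
    have : ((s : ℝ) + 1 + s) / (2 * s + 1) = 1 := by
      rw [div_eq_one_iff_eq (by positivity)]; ring
    rw [this, sub_self, zero_div, zero_div, sub_zero] at e
    rw [e]
    unfold Rf
    congr 1
    · ring
    · ring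
  unfold Fa Pf Qf
  rw [e3, gP_succ]
  have e4 : Yk s k ^ 2 - ((s : ℝ) + 1 / 2) ^ 2 = Yk s k ^ 2 - ((s : ℝ) + 3 / 2) ^ 2 + 2 * (s + 1) := by ring
  rw [e4] at t0 ⊢
  generalize Yk s k ^ 2 - ((s : ℝ) + 3 / 2) ^ 2 = up at *
  generalize gP s ((s : ℝ) + 1 / 2) = G at *
  generalize (s : ℝ) + 1 / 2 = M at *
  clear e e3 e4 H H2 hP hQ tm
  field_simp
  ring

lemma inner_eq (s a : ℕ) (hs : 1 ≤ s) :
    ∑ i ∈ Finset.range (s / 2), Fa a (Xi s i) ((s : ℝ) + 1 / 2) =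
      4 * ((s : ℝ) + 1 / 2) / gP a ((s : ℝ) + 1 / 2) *
        (Pt s a ((s : ℝ) + 1 / 2) + kp s (-a) ^ 2 * Pt s a ((s : ℝ) + 3 / 2)
          + km s (-a) ^ 2 * Pt s a ((s : ℝ) - 1 / 2)
          - b0 s (-a) * Qt s a ((s : ℝ) + 1 / 2)
          - bp s (-a) * Qt s a ((s : ℝ) + 3 / 2)
          - bm s (-a) * Qt s a ((s : ℝ) - 1 / 2)) := by
  have hs' : (0 : ℝ) < s := by exact_mod_cast hs
  unfold Pt Qt
  simp only [Finset.mul_sum, ← Finset.sum_sub_distrib, ← Finset.sum_add_distrib]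
  refine Finset.sum_congr rfl fun i hi => ?_
  have hi := Finset.mem_range.mp hi
  have t0 := Xi_ne s i hi ((s : ℝ) + 1 / 2) (by linarith)
  have tp := Xi_ne s i hi ((s : ℝ) + 3 / 2) (by linarith)
  have tm := Xi_ne s i hi ((s : ℝ) - 1 / 2) (by linarith)
  unfold Fa
  rw [Rf_sq' s a _ hs' t0 tp tm]
  generalize ((s : ℝ) + 1 / 2) ^ 2 - Xi s i ^ 2 = u0 at *
  generalize ((s : ℝ) + 3 / 2) ^ 2 - Xi s i ^ 2 = up at *
  generalize ((s : ℝ) - 1 / 2) ^ 2 - Xi s i ^ 2 = um at *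
  ring

end VA
end

section
open MeasureTheory Real Finset

namespace VA

/-- pure algebra: combining outer and inner sums -/
lemma D_alg (s a G P0 Pp Pm T0 Tp Tm Q0 Qp Qm U0 Up Um Gp Gm : ℝ) (hG : G ≠ 0)
    (h1 : s - a + 1 ≠ 0) (h2 : s + a + 1 ≠ 0) (h3 : s - a ≠ 0) (h4 : s + a ≠ 0) (h5 : 0 < s)
    (h8 : 2 * s - 1 ≠ 0)
    (eGp : Gp = G * (s + a + 1) / (s - a + 1)) (eGm : Gm = G * (s - a) / (s + a)) :
    4 * (s + 1 / 2) * G * (P0 + kp s a ^ 2 * Pp + km s a ^ 2 * Pm + b0 s a * (Q0 / G)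
        + bp s a * (Qp / Gp) + bm s a * (Qm / Gm))
      - 4 * (s + 1 / 2) / G * (T0 + kp s (-a) ^ 2 * Tp + km s (-a) ^ 2 * Tm
        - b0 s (-a) * U0 - bp s (-a) * Up - bm s (-a) * Um) =
    4 * (s + 1 / 2) * (G * P0 - T0 / G)
      + (2 * s + 1) / (2 * s + 3) * ((s + 1) ^ 2 - a ^ 2) / (2 * s + 1) ^ 2 *
        (4 * (s + 3 / 2) * (Gp * Pp - Tp / Gp))
      + (2 * s + 1) / (2 * s - 1) * (s ^ 2 - a ^ 2) / (2 * s + 1) ^ 2 *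
        (4 * (s - 1 / 2) * (Gm * Pm - Tm / Gm))
      + 4 * (s + 1 / 2) * ((4 * a ^ 2 - 3 * (2 * s + 1) ^ 2 - 1) / (2 * (2 * s + 1) ^ 3) * (Qp - Qm)
        - b0 s (-a) * (Q0 - U0 / G)
        - bp s (-a) * ((s + a + 1) / (s - a + 1)) * (Qp - Up / Gp)
        - bm s (-a) * ((s - a) / (s + a)) * (Qm - Um / Gm)) := by
  have h6 : s * 2 + 1 ≠ 0 := by positivity
  have h7 : s * 2 + 3 ≠ 0 := by positivity
  have h9 : s * 2 - 1 ≠ 0 := by rwa [mul_comm]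
  have hp0 : Gp ≠ 0 := by rw [eGp]; exact div_ne_zero (mul_ne_zero hG h2) h1
  have hm0 : Gm ≠ 0 := by rw [eGm]; exact div_ne_zero (mul_ne_zero hG h3) h4
  have c1 : G * kp s a ^ 2 * Pp = ((s + 1) ^ 2 - a ^ 2) / (2 * s + 1) ^ 2 * (Gp * Pp) := by
    rw [eGp]; unfold kp; field_simp; ring
  have c2 : kp s (-a) ^ 2 * Tp / G = ((s + 1) ^ 2 - a ^ 2) / (2 * s + 1) ^ 2 * (Tp / Gp) := by
    rw [eGp]; unfold kp; rw [← sub_eq_add_neg, show s + 1 - a = s - a + 1 by ring]; field_simp; ring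
  have c3 : G * km s a ^ 2 * Pm = (s ^ 2 - a ^ 2) / (2 * s + 1) ^ 2 * (Gm * Pm) := by
    rw [eGm]; unfold km; field_simp; ring
  have c4 : km s (-a) ^ 2 * Tm / G = (s ^ 2 - a ^ 2) / (2 * s + 1) ^ 2 * (Tm / Gm) := by
    rw [eGm]; unfold km; rw [sub_neg_eq_add]; field_simp; ring
  have c5 : (2 * s + 1) / (2 * s + 3) * ((s + 1) ^ 2 - a ^ 2) / (2 * s + 1) ^ 2 *
        (4 * (s + 3 / 2)) = 4 * (s + 1 / 2) * (((s + 1) ^ 2 - a ^ 2) / (2 * s + 1) ^ 2) := by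
    field_simp
  have c6 : (2 * s + 1) / (2 * s - 1) * (s ^ 2 - a ^ 2) / (2 * s + 1) ^ 2 *
        (4 * (s - 1 / 2)) = 4 * (s + 1 / 2) * ((s ^ 2 - a ^ 2) / (2 * s + 1) ^ 2) := by
    field_simp
  have c7 : G * (bp s a * (Qp / Gp)) = bp s a * ((s - a + 1) / (s + a + 1)) * Qp := by
    rw [eGp]; field_simp
  have c8 : G * (bm s a * (Qm / Gm)) = bm s a * ((s + a) / (s - a)) * Qm := by
    rw [eGm]; field_simp
  have c9 : bp s (-a) * Up / G = bp s (-a) * ((s + a + 1) / (s - a + 1)) * (Up / Gp) := by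
    rw [eGp]; field_simp
  have c10 : bm s (-a) * Um / G = bm s (-a) * ((s - a) / (s + a)) * (Um / Gm) := by
    rw [eGm]; field_simp
  have c11 : b0 s a = - b0 s (-a) := by unfold b0; ring
  have c12 : bp s a * ((s - a + 1) / (s + a + 1)) + bp s (-a) * ((s + a + 1) / (s - a + 1)) =
      (4 * a ^ 2 - 3 * (2 * s + 1) ^ 2 - 1) / (2 * (2 * s + 1) ^ 3) := by
    unfold bp
    rw [← sub_eq_add_neg, sub_neg_eq_add, show s + 1 - a = s - a + 1 by ring,
      show s + 1 + a = s + a + 1 by ring]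
    field_simp; ring
  have c13 : bm s a * ((s + a) / (s - a)) + bm s (-a) * ((s - a) / (s + a)) =
      -(4 * a ^ 2 - 3 * (2 * s + 1) ^ 2 - 1) / (2 * (2 * s + 1) ^ 3) := by
    unfold bm
    rw [← sub_eq_add_neg, sub_neg_eq_add]
    field_simp; ring
  have c14 : G * (b0 s a * (Q0 / G)) = - b0 s (-a) * Q0 := by rw [c11]; field_simp
  set N := (4 * a ^ 2 - 3 * (2 * s + 1) ^ 2 - 1) / (2 * (2 * s + 1) ^ 3) with hN
  rw [neg_div, ← hN] at c13
  linear_combination 4 * (s + 1 / 2) * (c1 + c3 + c14 + c7 + c8 - c2 - c4 + c9 + c10 + c12 * Qp + c13 * Qm)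
    - c5 * (Gp * Pp - Tp / Gp) - c6 * (Gm * Pm - Tm / Gm)

noncomputable def Dcl (s a p1 p2 p3 : ℝ) : ℝ :=
  (p1 + p2 / 2 - 2 * p3 + 1 / (2 * s + 1) ^ 2)
  + (2 * s + 1) / (2 * s + 3) * ((s + 1) ^ 2 - a ^ 2) / (2 * s + 1) ^ 2 *
    ((2 * s + 1) * (2 * s + 3) / (2 * (s + 1) * (s + a + 1)) + p2 / 2 - 1 - 1 / (4 * (s + 1) ^ 2))
  + (2 * s + 1) / (2 * s - 1) * (s ^ 2 - a ^ 2) / (2 * s + 1) ^ 2 *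
    (-((2 * s + 1) * (2 * s - 1)) / (2 * s * (s + a)) + p2 / 2 + 1 + 1 / (4 * s ^ 2))
  + 4 * (s + 1 / 2) * ((4 * a ^ 2 - 3 * (2 * s + 1) ^ 2 - 1) / (2 * (2 * s + 1) ^ 3) *
      ((2 * s + 1) / (2 * (s + a + 1)) - (2 * s + 1) / (4 * (s + 1)))
    - b0 s (-a) * ((s - a) / (2 * (2 * s + 1) * (s + a + 1)))
    - bp s (-a) * ((s + a + 1) / (s - a + 1)) *
      ((2 * s + 1) * (s - a + 1) / (4 * (s + 1) * (s + a + 1)))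
    - bm s (-a) * ((s - a) / (s + a)) * (-(2 * s + 1) * (s - a - 1) / (4 * s * (s + a + 1))))

lemma D_eq (s a : ℕ) (h : a + 2 ≤ s) :
    (∑' k, Fa a ((s : ℝ) + 1 / 2) (Yk s k)) -
      ∑ i ∈ Finset.range (s / 2), Fa a (Xi s i) ((s : ℝ) + 1 / 2) =
      Dcl s a (psi1 (s + a + 1)) (psi1 (s + 1)) (psi1 (2 * s + 1)) := by
  have hA : (a : ℝ) + 2 ≤ s := by exact_mod_cast h
  have ha0 : (0 : ℝ) ≤ a := Nat.cast_nonneg a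
  rw [(outer_hasSum s a (by omega) (by omega)).tsum_eq, inner_eq s a (by omega)]
  unfold Dcl
  rw [← WW_M s a (by omega), ← WW_p s a (by omega), ← WW_m s a (by omega),
    ← dl_M s (s - a) a (by omega), ← dl_p s (s - a) a (by omega), ← dl_m s (s - 1 - a) a (by omega)]
  have hq := qq_diff s (s - a) (a + 1) (by omega) (by omega)
  push_cast at hq
  rw [← add_assoc] at hq
  rw [← hq]
  have G0 := (gP_pos a ((s : ℝ) + 1 / 2) (by linarith)).ne'
  have Gp := (gP_pos a ((s : ℝ) + 3 / 2) (by linarith)).ne'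
  have Gm := (gP_pos a ((s : ℝ) - 1 / 2) (by linarith)).ne'
  have key := D_alg s a (gP a ((s : ℝ) + 1 / 2)) (Ps s a ((s : ℝ) + 1 / 2)) (Ps s a ((s : ℝ) + 3 / 2))
    (Ps s a ((s : ℝ) - 1 / 2)) (Pt s a ((s : ℝ) + 1 / 2)) (Pt s a ((s : ℝ) + 3 / 2))
    (Pt s a ((s : ℝ) - 1 / 2)) (qq s (a + 1) ((s : ℝ) + 1 / 2)) (qq s (a + 1) ((s : ℝ) + 3 / 2))
    (qq s (a + 1) ((s : ℝ) - 1 / 2)) (Qt s a ((s : ℝ) + 1 / 2)) (Qt s a ((s : ℝ) + 3 / 2))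
    (Qt s a ((s : ℝ) - 1 / 2)) (gP a ((s : ℝ) + 3 / 2)) (gP a ((s : ℝ) - 1 / 2)) G0
    (by linarith) (by positivity) (by linarith) (by linarith) (by linarith) (by linarith)
    (by rw [eq_div_iff (by linarith), g13])
    (by rw [eq_div_iff (by linarith), gm1])
  unfold WW dl
  rw [← key]
  have e : ∀ r : ℝ, gP a r ≠ 0 → qq s (a + 1) r / gP a r =
      (r ^ 2 - ((a : ℝ) + 1 / 2) ^ 2) * Qs s (a + 1) r := by
    intro r hr
    unfold qq
    rw [gP_succ, mul_assoc, mul_div_cancel_left₀ _ hr]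
  rw [e _ G0, e _ Gp, e _ Gm]

lemma D0_eq (s : ℕ) :
    (∑' k, Fa s ((s : ℝ) + 1 / 2) (Yk s k)) =
      (psi1 (2 * s + 1) + psi1 (s + 1) / 2 - 2 * psi1 (2 * s + 1) + 1 / (2 * (s : ℝ) + 1) ^ 2)
      + ((2 * s + 3) / (2 * ((s : ℝ) + 1)) + psi1 (s + 1) / 2 - 1 - 1 / (4 * ((s : ℝ) + 1) ^ 2)) / (2 * s + 3)
      - 1 / (2 * ((s : ℝ) + 1) ^ 2) := by
  rw [(outer_hasSum0 s).tsum_eq]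
  have w0 := WW_M s s le_rfl
  have wp := WW_p s s le_rfl
  have dp := dl_p s 0 s (by omega)
  unfold WW at w0 wp
  unfold dl qq at dp
  rw [Pt_zero s s _ (by omega), zero_div, sub_zero] at w0 wp
  rw [Qt_zero s s _ (by omega), zero_div, sub_zero, gP_succ, e_p] at dp
  have hg := g13 s s
  rw [← two_mul] at w0
  have h1 : (2 * (s : ℝ) + 1) ≠ 0 := by positivity
  have h2 : (2 * (s : ℝ) + 3) ≠ 0 := by positivity
  have h3 : ((s : ℝ) + 1) ≠ 0 := by positivity
  have hg' : gP s ((s : ℝ) + 3 / 2) = gP s ((s : ℝ) + 1 / 2) * (2 * s + 1) := by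
    linear_combination hg
  rw [hg'] at wp dp
  generalize gP s ((s : ℝ) + 1 / 2) = G at *
  generalize Ps s s ((s : ℝ) + 1 / 2) = P0 at *
  generalize Ps s s ((s : ℝ) + 3 / 2) = Pp at *
  generalize Qs s (s + 1) ((s : ℝ) + 3 / 2) = Q at *
  rw [← w0]
  have wp' : 4 * ((s : ℝ) + 1 / 2) * G * Pp = ((2 * s + 3) / (2 * ((s : ℝ) + 1)) + psi1 (s + 1) / 2 - 1
      - 1 / (4 * ((s : ℝ) + 1) ^ 2)) / (2 * s + 3) := by
    rw [eq_div_iff h2]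
    have : (2 * s + 1) * (2 * s + 3) / (2 * ((s : ℝ) + 1) * (s + s + 1)) =
      (2 * s + 3) / (2 * ((s : ℝ) + 1)) := by
      rw [show (s : ℝ) + s + 1 = 2 * s + 1 by ring]; field_simp
    rw [this] at wp
    rw [← wp]; ring
  rw [← wp']
  have dp' : 4 * ((s : ℝ) + 1 / 2) * G * (2 * Q) = 1 / (2 * ((s : ℝ) + 1) ^ 2) := by
    have e1 : (2 * s + 1) * ((s : ℝ) - s + 1) / (4 * (s + 1) * (s + s + 1)) = 1 / (4 * ((s : ℝ) + 1)) := by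
      rw [show (s : ℝ) + s + 1 = 2 * s + 1 by ring, show (s : ℝ) - s + 1 = 1 by ring]; field_simp
    rw [e1] at dp
    have e2 : 1 / (2 * ((s : ℝ) + 1) ^ 2) = 1 / (4 * ((s : ℝ) + 1)) * (2 / (s + 1)) := by
      field_simp; norm_num
    rw [e2, ← dp]
    field_simp
    ring
  linear_combination -dp'

end VA
end

section
open MeasureTheory Real Finset

namespace VA

noncomputable def nd (a j : ℕ) : ℝ := 2 * (j : ℝ) + a + 1 / 2

noncomputable def Vs (a m : ℕ) : ℝ := ∑ j ∈ Finset.range m, ∑' k, Fa a (nd a j) (nd a (m + k))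

noncomputable def target (m n : ℕ) : ℝ :=
  (1 / 2 - (m : ℝ) - n) * psi1 (2 * m + 2 * n) + ((n : ℝ) - 1 / 2) * psi1 (2 * n)
        + ((m : ℝ) * (2 * m + n - 1) / (2 * m + 2 * n - 1) - 1 / 8) * psi1 (m + n)
        + psi1 n / 8 - 1 / 2 * (psi0 (2 * m + 2 * n) - psi0 (2 * n))

lemma nd_eq (a j : ℕ) : nd a j = ((2 * j + a : ℕ) : ℝ) + 1 / 2 := by
  unfold nd; push_cast; ring

lemma nd_Yk (a j k : ℕ) : nd a (j + 1 + k) = Yk (2 * j + a) k := by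
  unfold nd Yk; push_cast; ring

lemma Fa_summable0 (a j : ℕ) : Summable fun k => Fa a (nd a j) (nd a (j + 1 + k)) := by
  simp_rw [nd_Yk]
  rw [nd_eq]
  cases j with
  | zero =>
    have := (outer_hasSum0 a).summable
    simpa using this
  | succ j =>
    exact (outer_hasSum (2 * (j + 1) + a) a (by omega) (by omega)).summable

lemma Fa_summable (a j m : ℕ) (h : j < m) : Summable fun k => Fa a (nd a j) (nd a (m + k)) := by
  have := (summable_nat_add_iff (m - (j + 1))).mpr (Fa_summable0 a j)
  have e : (fun k => Fa a (nd a j) (nd a (m + k))) =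
      fun k => Fa a (nd a j) (nd a (j + 1 + (k + (m - (j + 1))))) := by
    funext k
    rw [show j + 1 + (k + (m - (j + 1))) = m + k by omega]
  rw [e]; exact this

lemma Vs_succ (a m : ℕ) : Vs a (m + 1) = Vs a m +
    ((∑' k, Fa a (((2 * m + a : ℕ) : ℝ) + 1 / 2) (Yk (2 * m + a) k)) -
      ∑ i ∈ Finset.range ((2 * m + a) / 2), Fa a (Xi (2 * m + a) i) (((2 * m + a : ℕ) : ℝ) + 1 / 2)) := by
  unfold Vs
  rw [Finset.sum_range_succ]
  have h1 : ∑ j ∈ Finset.range m, ∑' k, Fa a (nd a j) (nd a (m + k)) =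
      ∑ j ∈ Finset.range m, (Fa a (nd a j) (nd a m) + ∑' k, Fa a (nd a j) (nd a (m + 1 + k))) := by
    refine Finset.sum_congr rfl fun j hj => ?_
    rw [(Fa_summable a j m (Finset.mem_range.mp hj)).tsum_eq_zero_add]
    simp only [add_zero]
    congr 1
    refine tsum_congr fun k => ?_
    rw [show m + (k + 1) = m + 1 + k by ring]
  rw [h1, Finset.sum_add_distrib]
  have h2 : ∑ i ∈ Finset.range ((2 * m + a) / 2), Fa a (Xi (2 * m + a) i) (((2 * m + a : ℕ) : ℝ) + 1 / 2)
      = ∑ j ∈ Finset.range m, Fa a (nd a j) (nd a m) := by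
    rw [← Finset.sum_range_reflect (n := m)]
    have hsub : Finset.range m ⊆ Finset.range ((2 * m + a) / 2) := by
      apply Finset.range_subset_range.mpr; omega
    rw [← Finset.sum_subset hsub]
    · refine Finset.sum_congr rfl fun i hi => ?_
      have hi := Finset.mem_range.mp hi
      rw [nd_eq a m]
      congr 1
      unfold Xi nd
      rw [Nat.sub_sub, Nat.cast_sub (by omega)]
      push_cast; ring
    · intro i hi hi2
      have hi := Finset.mem_range.mp hi
      have hi2 : m ≤ i := by simpa using hi2
      unfold Fa
      rw [gP_eq_zero' a (2 * m + a - 2 - 2 * i) (by omega)]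
      · simp
      · unfold Xi
        rw [Nat.cast_sub (by omega), Nat.cast_sub (by omega)]; push_cast; ring
  rw [h2, nd_eq a m]
  simp_rw [nd_Yk]
  ring

lemma Vs_one (a : ℕ) : Vs a 1 = target 1 (1 + a) := by
  rw [Vs_succ a 0]
  unfold Vs
  simp only [Finset.range_zero, Finset.sum_empty, mul_zero, zero_add]
  have : ∑ i ∈ Finset.range (a / 2), Fa a (Xi a i) ((a : ℝ) + 1 / 2) = 0 := by
    refine Finset.sum_eq_zero fun i hi => ?_
    unfold Fa
    rw [gX_zero a a i (Finset.mem_range.mp hi) (by omega)]; simp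
  rw [this, sub_zero, D0_eq]
  unfold target
  rw [show 2 * 1 + 2 * (1 + a) = 2 * a + 1 + 1 + 1 + 1 by ring, show 2 * (1 + a) = 2 * a + 1 + 1 by ring,
    show 1 + (1 + a) = a + 1 + 1 by ring, show 1 + a = a + 1 by ring,
    psi1_succ (2 * a + 1 + 1 + 1) (by omega), psi1_succ (2 * a + 1 + 1) (by omega),
    psi1_succ (2 * a + 1) (by omega), psi1_succ (a + 1) (by omega),
    psi0_succ (2 * a + 1 + 1 + 1) (by omega), psi0_succ (2 * a + 1 + 1) (by omega)]
  generalize psi1 (2 * a + 1) = p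
  generalize psi1 (a + 1) = q
  generalize psi0 (2 * a + 1 + 1) = r
  push_cast
  have ha0 : (0 : ℝ) ≤ a := Nat.cast_nonneg a
  rw [show (2 * (a : ℝ) + 1 + 1 + 1) = 2 * a + 3 by ring, show (2 * (a : ℝ) + 1 + 1) = 2 * (a + 1) by ring,
    show 2 * (1 : ℝ) + 2 * (a + 1) - 1 = 2 * a + 3 by ring]
  field_simp
  ring

lemma target_succ (m a : ℕ) (hm : 1 ≤ m) :
    target (m + 1) (m + 1 + a) = target m (m + a) +
      Dcl ((2 * m + a : ℕ) : ℝ) a (psi1 (2 * m + a + a + 1)) (psi1 (2 * m + a + 1))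
        (psi1 (2 * (2 * m + a) + 1)) := by
  have hm' : (1 : ℝ) ≤ m := by exact_mod_cast hm
  have ha0 : (0 : ℝ) ≤ a := Nat.cast_nonneg a
  unfold target Dcl
  -- arguments
  rw [show 2 * (m + 1) + 2 * (m + 1 + a) = 2 * m + 2 * (m + a) + 1 + 1 + 1 + 1 by ring,
    show 2 * (m + 1 + a) = 2 * (m + a) + 1 + 1 by ring,
    show m + 1 + (m + 1 + a) = m + (m + a) + 1 + 1 by ring,
    show m + 1 + a = m + a + 1 by ring,
    show 2 * m + a + a + 1 = 2 * (m + a) + 1 by ring,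
    show 2 * m + a + 1 = m + (m + a) + 1 by ring,
    show 2 * (2 * m + a) + 1 = 2 * m + 2 * (m + a) + 1 by ring]
  obtain ⟨N, hN⟩ : ∃ N, N = m + a := ⟨_, rfl⟩
  rw [← hN]
  rw [psi1_succ (2 * m + 2 * N + 1 + 1 + 1) (by omega), psi1_succ (2 * m + 2 * N + 1 + 1) (by omega),
    psi1_succ (2 * m + 2 * N + 1) (by omega), psi1_succ (2 * m + 2 * N) (by omega),
    psi0_succ (2 * m + 2 * N + 1 + 1 + 1) (by omega), psi0_succ (2 * m + 2 * N + 1 + 1) (by omega),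
    psi0_succ (2 * m + 2 * N + 1) (by omega), psi0_succ (2 * m + 2 * N) (by omega),
    psi1_succ (2 * N + 1) (by omega), psi1_succ (2 * N) (by omega),
    psi0_succ (2 * N + 1) (by omega), psi0_succ (2 * N) (by omega),
    psi1_succ (m + N + 1) (by omega), psi1_succ (m + N) (by omega), psi1_succ N (by omega)]
  generalize psi1 (2 * m + 2 * N) = p1
  generalize psi1 (2 * N) = p2
  generalize psi1 (m + N) = p3
  generalize psi1 N = p4
  generalize psi0 (2 * m + 2 * N) = p5
  generalize psi0 (2 * N) = p6
  have ea : (a : ℝ) = N - m := by rw [hN]; push_cast; ring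
  have hN' : (m : ℝ) ≤ N := by rw [hN]; push_cast; linarith
  push_cast
  rw [ea]
  unfold b0 bp bm
  generalize (m : ℝ) = x at *
  generalize (N : ℝ) = y at *
  clear hN ea ha0
  obtain ⟨S, hS⟩ : ∃ S, S = x + y := ⟨_, rfl⟩
  have hx : x = S - y := by linarith
  have hS0 : 0 < S := by linarith
  have hy0 : 0 < y := by linarith
  have n1 : 2 * S - 1 ≠ 0 := by linarith
  have n2 : 2 * x + 1 ≠ 0 := by linarith
  rw [show 2 * x + (y - x) = S by linarith]
  rw [show 2 * (x + 1) + 2 * (y + 1) - 1 = 2 * S + 3 by linarith,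
    show 2 * x + 2 * y - 1 = 2 * S - 1 by linarith,
    show 2 * x + 2 * y = 2 * S by linarith,
    show 2 * S + 1 + 1 + 1 = 2 * S + 3 by ring,
    show 2 * S + 1 + 1 = 2 * (S + 1) by ring,
    show S + (y - x) = 2 * y by linarith,
    show S - (y - x) + 1 = 2 * x + 1 by linarith,
    show S - (y - x) = 2 * x by linarith,
    show S + 1 + -(y - x) = 2 * x + 1 by linarith,
    show S - -(y - x) = 2 * y by linarith,
    ← hS]
  have e1 : ∀ A : ℝ, A * ((2 * y + 1) / (2 * x + 1)) * ((2 * S + 1) * (2 * x + 1) / (4 * (S + 1) * (2 * y + 1)))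
      = A * (2 * S + 1) / (4 * (S + 1)) := by
    intro A
    have n2' : x * 2 + 1 ≠ 0 := by linarith
    field_simp
  rw [e1]
  clear e1 n2
  have n1' : S * 2 - 1 ≠ 0 := by linarith
  clear hN' hm' hm hS
  subst hx
  field_simp
  ring

theorem Vs_eq (a m : ℕ) (hm : 1 ≤ m) : Vs a m = target m (m + a) := by
  induction m with
  | zero => omega
  | succ m ih =>
    rcases Nat.eq_zero_or_pos m with h | h
    · subst h; exact Vs_one a
    · rw [Vs_succ, ih h, target_succ m a h, D_eq _ _ (by omega)]

end VA
end

section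
namespace VA
open Polynomial

/-- Gegenbauer polynomials with parameter `a + 1/2`. -/
noncomputable def Gg (a : ℕ) : ℕ → ℝ[X]
  | 0 => 1
  | 1 => C (2 * (a : ℝ) + 1) * X
  | (k + 2) => C (1 / ((k : ℝ) + 2)) * (C (2 * (k : ℝ) + 2 * a + 3) * X * Gg a (k + 1)
      - C ((k : ℝ) + 1 + 2 * a) * Gg a k)

lemma Gg_rec (a k : ℕ) : C ((k : ℝ) + 2) * Gg a (k + 2) =
    C (2 * (k : ℝ) + 2 * a + 3) * X * Gg a (k + 1) - C ((k : ℝ) + 1 + 2 * a) * Gg a k := by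
  rw [Gg, ← mul_assoc, ← C_mul]
  rw [mul_one_div_cancel (by positivity), C_1, one_mul]

lemma Gg_I (a k : ℕ) :
    (X * derivative (Gg a (k + 1)) - derivative (Gg a k) = C ((k : ℝ) + 1) * Gg a (k + 1)) ∧
    (derivative (Gg a (k + 1)) - X * derivative (Gg a k) = C ((k : ℝ) + 2 * a + 1) * Gg a k) := by
  induction k with
  | zero =>
    simp [Gg]
    ring
  | succ k ih =>
    obtain ⟨h1, h2⟩ := ih
    have hd := congrArg derivative (Gg_rec a k)
    simp only [derivative_mul, derivative_sub, derivative_C, derivative_X, zero_mul, zero_add, mul_one] at hd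
    have hr := Gg_rec a k
    have hne : C ((k : ℝ) + 2) ≠ 0 := by
      rw [Ne, C_eq_zero]; positivity
    simp only [map_add, map_mul, map_one, map_ofNat, Nat.cast_add, Nat.cast_one] at *
    have e2 : derivative (Gg a (k + 1 + 1)) - X * derivative (Gg a (k + 1))
        = (C (k : ℝ) + 1 + 2 * C (a : ℝ) + 1) * Gg a (k + 1) := by
      apply mul_left_cancel₀ hne
      linear_combination hd + (-(C (k : ℝ) + 1 + 2 * C (a : ℝ))) * (-h1)
    refine ⟨?_, e2⟩
    show X * derivative (Gg a (k + 2)) - derivative (Gg a (k + 1)) = (C (k : ℝ) + 1 + 1) * Gg a (k + 2)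
    have e2' : derivative (Gg a (k + 2)) - X * derivative (Gg a (k + 1))
        = (C (k : ℝ) + 1 + 2 * C (a : ℝ) + 1) * Gg a (k + 1) := e2
    linear_combination X * e2' - hr + X * h1 - h2

lemma Gg_J (a k : ℕ) : (1 - X ^ 2) * derivative (Gg a (k + 1)) =
    - C ((k : ℝ) + 1) * X * Gg a (k + 1) + C ((k : ℝ) + 1 + 2 * a) * Gg a k := by
  obtain ⟨h1, h2⟩ := Gg_I a k
  simp only [map_add, map_mul, map_one, map_ofNat] at *
  linear_combination h2 - X * h1

lemma Gg_ode (a k : ℕ) : (1 - X ^ 2) * derivative (derivative (Gg a k))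
    - C (2 * ((a : ℝ) + 1)) * X * derivative (Gg a k) + C ((k : ℝ) * (k + 2 * a + 1)) * Gg a k = 0 := by
  cases k with
  | zero => simp [Gg]
  | succ k =>
    have hJ := congrArg derivative (Gg_J a k)
    simp only [derivative_mul, derivative_sub, derivative_add, derivative_neg, derivative_C, derivative_X,
      zero_mul, zero_add, mul_one, derivative_one, derivative_X_pow] at hJ
    obtain ⟨h1, h2⟩ := Gg_I a k
    push_cast at *
    simp only [map_add, map_mul, map_one, map_ofNat, neg_zero, zero_mul, zero_add, zero_sub, Nat.add_one_sub_one, pow_one] at *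
    linear_combination hJ - (C (k : ℝ) + 1 + 2 * C (a : ℝ)) * h1

lemma Gg_d0 (a : ℕ) : derivative (Gg a 0) = 0 := by simp [Gg]

lemma Gg_dd (a k : ℕ) : derivative (Gg a (k + 2)) =
    derivative (Gg a k) + C (2 * ((k : ℝ) + 1 + a) + 1) * Gg a (k + 1) := by
  obtain ⟨h1, _⟩ := Gg_I a k
  obtain ⟨_, h2⟩ := Gg_I a (k + 1)
  push_cast at *
  simp only [map_add, map_mul, map_one, map_ofNat] at *
  linear_combination h1 + h2

end VA
end

section
namespace VA
open Polynomial

noncomputable def gJ (a : ℕ) (P : ℝ[X]) : ℝ := ∫ x in (-1 : ℝ)..1, (1 - x ^ 2) ^ a * P.eval x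
noncomputable def gL (a : ℕ) (P : ℝ[X]) : ℝ :=
  ∫ x in (-1 : ℝ)..1, Real.log (1 - x) * ((1 - x ^ 2) ^ a * P.eval x)

lemma gJ_int (a : ℕ) (P : ℝ[X]) : IntervalIntegrable (fun x : ℝ => (1 - x ^ 2) ^ a * P.eval x)
    MeasureTheory.volume (-1) 1 := by
  apply Continuous.intervalIntegrable
  fun_prop

lemma gL_int (a : ℕ) (P : ℝ[X]) :
    IntervalIntegrable (fun x : ℝ => Real.log (1 - x) * ((1 - x ^ 2) ^ a * P.eval x))
    MeasureTheory.volume (-1) 1 := by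
  apply IntervalIntegrable.mul_continuousOn
  · have h : IntervalIntegrable Real.log MeasureTheory.volume 2 0 := intervalIntegral.intervalIntegrable_log'
    have := h.comp_sub_left 1
    norm_num at this
    exact this
  · apply Continuous.continuousOn
    fun_prop

lemma gJ_add (a : ℕ) (P Q : ℝ[X]) : gJ a (P + Q) = gJ a P + gJ a Q := by
  unfold gJ
  rw [← intervalIntegral.integral_add (gJ_int a P) (gJ_int a Q)]
  congr 1; ext x; simp; ring

lemma gL_add (a : ℕ) (P Q : ℝ[X]) : gL a (P + Q) = gL a P + gL a Q := by
  unfold gL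
  rw [← intervalIntegral.integral_add (gL_int a P) (gL_int a Q)]
  congr 1; ext x; simp; ring

lemma gJ_smul (a : ℕ) (c : ℝ) (P : ℝ[X]) : gJ a (C c * P) = c * gJ a P := by
  unfold gJ
  rw [← intervalIntegral.integral_const_mul]
  congr 1; ext x; simp; ring

lemma gL_smul (a : ℕ) (c : ℝ) (P : ℝ[X]) : gL a (C c * P) = c * gL a P := by
  unfold gL
  rw [← intervalIntegral.integral_const_mul]
  congr 1; ext x; simp; ring

lemma gJ_sub (a : ℕ) (P Q : ℝ[X]) : gJ a (P - Q) = gJ a P - gJ a Q := by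
  have := gJ_add a (P - Q) Q
  rw [sub_add_cancel] at this; linarith

lemma gL_sub (a : ℕ) (P Q : ℝ[X]) : gL a (P - Q) = gL a P - gL a Q := by
  have := gL_add a (P - Q) Q
  rw [sub_add_cancel] at this; linarith

lemma w_deriv (a : ℕ) (R : ℝ[X]) (x : ℝ) : HasDerivAt (fun x : ℝ => (1 - x ^ 2) ^ (a + 1) * R.eval x)
    ((1 - x ^ 2) ^ a * ((1 - X ^ 2) * derivative R - C (2 * ((a : ℝ) + 1)) * X * R).eval x) x := by
  have h1 : HasDerivAt (fun x : ℝ => 1 - x ^ 2) (-(2 * x)) x := by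
    simpa using (hasDerivAt_pow 2 x).const_sub 1
  have h2 := (h1.pow (a + 1)).mul (R.hasDerivAt x)
  refine HasDerivAt.congr_deriv h2 ?_
  simp
  ring

lemma gJ_ibp (a : ℕ) (R : ℝ[X]) :
    gJ a ((1 - X ^ 2) * derivative R - C (2 * ((a : ℝ) + 1)) * X * R) = 0 := by
  unfold gJ
  rw [intervalIntegral.integral_eq_sub_of_hasDerivAt (fun x _ => w_deriv a R x) (gJ_int a _)]
  norm_num

lemma gL_ibp (a : ℕ) (R : ℝ[X]) :
    gL a ((1 - X ^ 2) * derivative R - C (2 * ((a : ℝ) + 1)) * X * R) = gJ a ((1 + X) * R) := by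
  have key : ∫ x in (-1 : ℝ)..1, (Real.log (1 - x) * ((1 - x ^ 2) ^ a *
      ((1 - X ^ 2) * derivative R - C (2 * ((a : ℝ) + 1)) * X * R).eval x) -
      (1 - x ^ 2) ^ a * ((1 + X) * R).eval x) = 0 := by
    rw [intervalIntegral.integral_eq_sub_of_hasDerivAt_of_le (by norm_num)
      (f := fun x => ((1 - x) * Real.log (1 - x)) * ((1 + x) * ((1 - x ^ 2) ^ a * R.eval x)))]
    · norm_num
    · apply Continuous.continuousOn
      have h := Real.continuous_mul_log
      have h2 : Continuous fun x : ℝ => (1 - x) * Real.log (1 - x) := h.comp (continuous_const.sub continuous_id)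
      exact h2.mul (by fun_prop)
    · intro x hx
      have hx1 : 0 < 1 - x := by linarith [hx.2]
      have e : (fun x => ((1 - x) * Real.log (1 - x)) * ((1 + x) * ((1 - x ^ 2) ^ a * R.eval x)))
        = fun x => Real.log (1 - x) * ((1 - x ^ 2) ^ (a + 1) * R.eval x) := by
        ext x; rw [pow_succ]; ring
      rw [e]
      have hl : HasDerivAt (fun x : ℝ => Real.log (1 - x)) (-1 / (1 - x)) x :=
        ((hasDerivAt_id x).const_sub 1).log hx1.ne'
      refine HasDerivAt.congr_deriv (hl.mul (w_deriv a R x)) ?_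
      rw [pow_succ]
      have : (1 - x ^ 2) = (1 - x) * (1 + x) := by ring
      rw [show -1 / (1 - x) * ((1 - x ^ 2) ^ a * (1 - x ^ 2) * eval x R)
        = - ((1 - x ^ 2) ^ a * ((1 + x) * eval x R)) by
          nth_rw 2 [this]; field_simp]
      simp only [eval_mul, eval_add, eval_one, eval_X]
      ring
    · exact (gL_int a _).sub (gJ_int a _)
  rw [intervalIntegral.integral_sub (gL_int a _) (gJ_int a _)] at key
  unfold gL gJ; linarith

/-- eigenvalue difference -/
lemma Gg_wr (a j k : ℕ) :
    (1 - X ^ 2) * derivative (derivative (Gg a j) * Gg a k - Gg a j * derivative (Gg a k))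
      - C (2 * ((a : ℝ) + 1)) * X * (derivative (Gg a j) * Gg a k - Gg a j * derivative (Gg a k))
    = C ((k : ℝ) * (k + 2 * a + 1) - (j : ℝ) * (j + 2 * a + 1)) * (Gg a j * Gg a k) := by
  have h1 := Gg_ode a j
  have h2 := Gg_ode a k
  simp only [derivative_mul, derivative_sub, map_sub]
  linear_combination Gg a k * h1 - Gg a j * h2

noncomputable def hn (a k : ℕ) : ℝ := gJ a (Gg a k * Gg a k)

lemma Gg_orth (a j k : ℕ) (h : j ≠ k) : gJ a (Gg a j * Gg a k) = 0 := by
  have h1 := gJ_ibp a (derivative (Gg a j) * Gg a k - Gg a j * derivative (Gg a k))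
  rw [Gg_wr, gJ_smul] at h1
  have h2 : (k : ℝ) * (k + 2 * a + 1) - (j : ℝ) * (j + 2 * a + 1) = (k - j) * (k + j + 2 * a + 1) := by ring
  rw [h2] at h1
  have h3 : (k : ℝ) - j ≠ 0 := by
    rw [sub_ne_zero]; exact_mod_cast h.symm
  have h4 : (k : ℝ) + j + 2 * a + 1 ≠ 0 := by positivity
  simpa [h3, h4] using h1

lemma hn_rec (a k : ℕ) : ((k : ℝ) + 1) * (((k : ℝ) + 1) + a + 1 / 2) * hn a (k + 1)
    = ((k : ℝ) + 1 + 2 * a) * ((k : ℝ) + a + 1 / 2) * hn a k := by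
  have h1 : ((k : ℝ) + 2) * gJ a (Gg a (k + 2) * Gg a k) =
      (2 * (k : ℝ) + 2 * a + 3) * gJ a (X * Gg a (k + 1) * Gg a k) - ((k : ℝ) + 1 + 2 * a) * hn a k := by
    unfold hn
    rw [← gJ_smul, ← gJ_smul, ← gJ_smul, ← gJ_sub]
    congr 1
    linear_combination (Gg a k) * Gg_rec a k
  rw [Gg_orth a _ _ (by omega)] at h1
  have h2 : ((k : ℝ) + 1) * hn a (k + 1) = (2 * (k : ℝ) + 2 * a + 1) * gJ a (X * Gg a (k + 1) * Gg a k) := by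
    cases k with
    | zero =>
      unfold hn
      rw [← gJ_smul, ← gJ_smul]
      congr 1
      simp [Gg]
      ring
    | succ k =>
      have h3 : ((k : ℝ) + 2) * gJ a (Gg a (k + 2) * Gg a (k + 2)) =
          (2 * (k : ℝ) + 2 * a + 3) * gJ a (X * Gg a (k + 2) * Gg a (k + 1)) -
          ((k : ℝ) + 1 + 2 * a) * gJ a (Gg a k * Gg a (k + 2)) := by
        rw [← gJ_smul, ← gJ_smul, ← gJ_smul, ← gJ_sub]
        congr 1
        linear_combination (Gg a (k + 2)) * Gg_rec a k
      rw [Gg_orth a k (k + 2) (by omega)] at h3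
      push_cast
      unfold hn
      show _ * gJ a (Gg a (k + 2) * Gg a (k + 2)) = _ * gJ a (X * Gg a (k + 2) * Gg a (k + 1))
      linear_combination h3
  linear_combination ((k : ℝ) + 1 + a + 1 / 2) * h2 - ((k : ℝ) + a + 1 / 2) * h1

lemma hn_gP (a k : ℕ) : ((k : ℝ) + a + 1 / 2) * hn a k * gP a ((a : ℝ) + 1 / 2)
    = ((a : ℝ) + 1 / 2) * hn a 0 * gP a ((k : ℝ) + a + 1 / 2) := by
  induction k with
  | zero => simp
  | succ k ih =>
    have h1 := hn_rec a k
    have h2 := gP_shift a ((k : ℝ) + a + 1 / 2)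
    have hk : ((k : ℝ) + 1) ≠ 0 := by positivity
    push_cast
    rw [show (k : ℝ) + 1 + a + 1 / 2 = k + a + 1 / 2 + 1 by ring]
    apply mul_left_cancel₀ hk
    linear_combination gP a ((a : ℝ) + 1 / 2) * h1 + ((k : ℝ) + 1 + 2 * a) * ih - (((a : ℝ) + 1 / 2) * hn a 0) * h2

lemma Ek (a j k : ℕ) : gJ a (Gg a j * derivative (Gg a k)) + gJ a (Gg a j * derivative (Gg a (k + 1)))
    = if j ≤ k then 2 * ((j : ℝ) + a + 1 / 2) * hn a j else 0 := by
  induction k with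
  | zero =>
    have h0 : gJ a (Gg a j * derivative (Gg a 0)) = 0 := by
      rw [Gg_d0]; simp [gJ]
    have h1 : gJ a (Gg a j * derivative (Gg a (0 + 1))) = (2 * (a : ℝ) + 1) * gJ a (Gg a j * Gg a 0) := by
      rw [← gJ_smul]; congr 1; simp [Gg]; ring
    rw [h0, h1]
    by_cases hj : j = 0
    · subst hj; rw [if_pos le_rfl]; unfold hn; push_cast; ring
    · rw [Gg_orth a j 0 hj]; simp [hj]
  | succ k ih =>
    have h1 : gJ a (Gg a j * derivative (Gg a (k + 1 + 1))) = gJ a (Gg a j * derivative (Gg a k))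
        + (2 * ((k : ℝ) + 1 + a) + 1) * gJ a (Gg a j * Gg a (k + 1)) := by
      rw [← gJ_smul, ← gJ_add]; congr 1
      rw [Gg_dd]; ring
    rw [h1, add_left_comm, ← add_assoc, ih]
    by_cases hj : j = k + 1
    · subst hj; rw [if_pos le_rfl, if_neg (by omega)]; unfold hn; push_cast; ring
    · rw [Gg_orth a j _ hj]
      have : j ≤ k ↔ j ≤ k + 1 := by omega
      simp [this]

lemma Tk (a j k : ℕ) (h : j ≠ k + 1) : gJ a ((1 + X) * (Gg a j * derivative (Gg a (k + 1)))) =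
    if j ≤ k then 2 * ((j : ℝ) + a + 1 / 2) * hn a j else 0 := by
  rw [← Ek]
  obtain ⟨h1, _⟩ := Gg_I a k
  have : (1 + X) * (Gg a j * derivative (Gg a (k + 1))) = Gg a j * derivative (Gg a k)
      + Gg a j * derivative (Gg a (k + 1)) + C ((k : ℝ) + 1) * (Gg a j * Gg a (k + 1)) := by
    linear_combination Gg a j * h1
  rw [this, gJ_add, gJ_add, gJ_smul, Gg_orth a _ _ h, mul_zero, add_zero]

lemma gL_val (a j k : ℕ) (h : j < k) :
    ((k : ℝ) * (k + 2 * a + 1) - (j : ℝ) * (j + 2 * a + 1)) * gL a (Gg a j * Gg a k)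
      = - (2 * ((j : ℝ) + a + 1 / 2) * hn a j) := by
  have h1 := gL_ibp a (derivative (Gg a j) * Gg a k - Gg a j * derivative (Gg a k))
  rw [Gg_wr, gL_smul, mul_sub, gJ_sub] at h1
  have h2 : gJ a ((1 + X) * (derivative (Gg a j) * Gg a k)) = 0 := by
    rw [mul_comm (derivative _)]
    cases j with
    | zero => rw [Gg_d0]; simp [gJ]
    | succ j => rw [Tk a k j (by omega), if_neg (by omega)]
  have h3 : gJ a ((1 + X) * (Gg a j * derivative (Gg a k))) = 2 * ((j : ℝ) + a + 1 / 2) * hn a j := by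
    obtain ⟨k, rfl⟩ : ∃ k', k = k' + 1 := ⟨k - 1, by omega⟩
    rw [Tk a j k (by omega), if_pos (by omega)]
  rw [h1, h2, h3, zero_sub]

end VA
end

section
namespace VA
open Polynomial

lemma Gg_even_odd (a k : ℕ) : ∃ G H : ℝ[X], Gg a (2 * k) = G.comp (X ^ 2) ∧ Gg a (2 * k + 1) = X * H.comp (X ^ 2)
    ∧ G.natDegree ≤ k ∧ 0 < G.coeff k ∧ H.natDegree ≤ k ∧ 0 < H.coeff k := by
  induction k with
  | zero =>
    refine ⟨1, C (2 * (a : ℝ) + 1), ?_, ?_, ?_, ?_, ?_, ?_⟩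
    · simp [Gg]
    · simp only [Gg, C_comp]; ring
    · simp
    · simp
    · exact (natDegree_C _).le
    · rw [coeff_C_zero]; positivity
  | succ k ih =>
    obtain ⟨G, H, hG, hH, dG, cG, dH, cH⟩ := ih
    have key : ∃ G' : ℝ[X], Gg a (2 * k + 2) = G'.comp (X ^ 2) ∧ G'.natDegree ≤ k + 1 ∧ 0 < G'.coeff (k + 1) := by
      refine ⟨C (1 / (((2 * k : ℕ) : ℝ) + 2)) * (C (2 * ((2 * k : ℕ) : ℝ) + 2 * a + 3) * (X * H)
        - C (((2 * k : ℕ) : ℝ) + 1 + 2 * a) * G), ?_, ?_, ?_⟩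
      · rw [Gg, hG, hH]
        simp only [mul_comp, sub_comp, C_comp, X_comp]
        ring
      · refine (natDegree_C_mul_le _ _).trans ((natDegree_sub_le _ _).trans (max_le ?_ ?_))
        · refine (natDegree_C_mul_le _ _).trans (natDegree_mul_le.trans ?_)
          have := natDegree_X_le (R := ℝ); omega
        · refine (natDegree_C_mul_le _ _).trans (by omega)
      · rw [coeff_C_mul, coeff_sub, coeff_C_mul, coeff_C_mul, coeff_X_mul, coeff_eq_zero_of_natDegree_lt (by omega : G.natDegree < k + 1)]
        simp only [mul_zero, sub_zero]; positivity
    obtain ⟨G', hG', dG', cG'⟩ := key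
    refine ⟨G', C (1 / (((2 * k + 1 : ℕ) : ℝ) + 2)) * (C (2 * ((2 * k + 1 : ℕ) : ℝ) + 2 * a + 3) * G'
        - C (((2 * k + 1 : ℕ) : ℝ) + 1 + 2 * a) * H), hG', ?_, dG', cG', ?_, ?_⟩
    · show Gg a ((2 * k + 1) + 2) = _
      rw [Gg, hG', hH]
      simp only [mul_comp, sub_comp, C_comp]
      ring
    · refine (natDegree_C_mul_le _ _).trans ((natDegree_sub_le _ _).trans (max_le ?_ ?_))
      · exact (natDegree_C_mul_le _ _).trans dG'
      · refine (natDegree_C_mul_le _ _).trans (by omega)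
    · rw [coeff_C_mul, coeff_sub, coeff_C_mul, coeff_C_mul, coeff_eq_zero_of_natDegree_lt (by omega : H.natDegree < k + 1)]
      simp only [mul_zero, sub_zero]; positivity

lemma hn_pos (a k : ℕ) : 0 < hn a k := by
  induction k with
  | zero =>
    unfold hn gJ
    apply intervalIntegral.intervalIntegral_pos_of_pos_on
    · exact gJ_int a _
    · intro x hx
      have : 0 < 1 - x ^ 2 := by nlinarith [hx.1, hx.2]
      simp [Gg]; positivity
    · norm_num
  | succ k ih =>
    have h := hn_rec a k
    have h1 : 0 < ((k : ℝ) + 1 + 2 * a) * ((k : ℝ) + a + 1 / 2) * hn a k := by positivity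
    rw [← h] at h1
    have h2 : 0 < ((k : ℝ) + 1) * (((k : ℝ) + 1) + a + 1 / 2) := by positivity
    exact (pos_iff_pos_of_mul_pos h1).mp h2

lemma vEnt_cont : Continuous vEnt := by
  have h := Real.continuous_mul_log
  have h1 : Continuous fun x : ℝ => (1 - x) / 2 * Real.log ((1 - x) / 2) := h.comp (by fun_prop)
  have h2 : Continuous fun x : ℝ => (1 + x) / 2 * Real.log ((1 + x) / 2) := h.comp (by fun_prop)
  exact h1.add h2

lemma half_int (a : ℕ) (P : ℝ[X]) (hP : ∀ x, P.eval (-x) = P.eval x) :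
    ∫ x in (0 : ℝ)..1, (1 - x ^ 2) ^ a * P.eval x = gJ a P / 2 := by
  have hc : Continuous fun x : ℝ => (1 - x ^ 2) ^ a * P.eval x := by fun_prop
  have h1 : ∫ x in (-1 : ℝ)..0, (1 - x ^ 2) ^ a * P.eval x = ∫ x in (0 : ℝ)..1, (1 - x ^ 2) ^ a * P.eval x := by
    have := intervalIntegral.integral_comp_neg (a := 0) (b := 1) (fun x : ℝ => (1 - x ^ 2) ^ a * P.eval x)
    rw [neg_zero] at this
    rw [← this]
    congr 1; ext x; rw [hP]; ring
  unfold gJ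
  rw [← intervalIntegral.integral_add_adjacent_intervals (hc.intervalIntegrable (-1) 0) (hc.intervalIntegrable 0 1), h1]
  ring

lemma vint (a : ℕ) (P : ℝ[X]) (hP : ∀ x, P.eval (-x) = P.eval x) :
    ∫ x in (0 : ℝ)..1, vEnt x * ((1 - x ^ 2) ^ a * P.eval x) =
      (gL a ((1 - X) * P) - Real.log 2 * gJ a ((1 - X) * P)) / 2 := by
  set u : ℝ → ℝ := fun x => ((1 - x) / 2 * Real.log ((1 - x) / 2)) * ((1 - x ^ 2) ^ a * P.eval x) with hu
  have huc : Continuous u := by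
    have h1 : Continuous fun x : ℝ => (1 - x) / 2 * Real.log ((1 - x) / 2) :=
      Real.continuous_mul_log.comp (by fun_prop)
    exact h1.mul (by fun_prop)
  have huc' : Continuous fun x => u (-x) := huc.comp continuous_neg
  have e1 : ∀ x, vEnt x * ((1 - x ^ 2) ^ a * P.eval x) = u x + u (-x) := by
    intro x
    simp only [hu, hP, vEnt, sub_neg_eq_add]; ring
  simp_rw [e1]
  rw [intervalIntegral.integral_add (huc.intervalIntegrable _ _) (huc'.intervalIntegrable _ _),
    intervalIntegral.integral_comp_neg, neg_zero, add_comm,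
    intervalIntegral.integral_add_adjacent_intervals (huc.intervalIntegrable _ _) (huc.intervalIntegrable _ _)]
  unfold gL gJ
  rw [← intervalIntegral.integral_const_mul, ← intervalIntegral.integral_sub (gL_int a _) ((gJ_int a _).const_mul _),
    ← intervalIntegral.integral_div]
  apply intervalIntegral.integral_congr
  intro x hx
  simp only [hu]
  rw [Set.uIcc_of_le (by norm_num)] at hx
  rcases eq_or_lt_of_le hx.2 with h | h
  · subst h; simp
  · rw [Real.log_div (by linarith) (by norm_num)]
    simp only [eval_mul, eval_sub, eval_one, eval_X]; ring

lemma Gg_even_eval (a k : ℕ) (x : ℝ) : (Gg a (2 * k)).eval (-x) = (Gg a (2 * k)).eval x := by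
  obtain ⟨G, H, hG, _⟩ := Gg_even_odd a k
  rw [hG]; simp

lemma gL_val' (a j k : ℕ) (h : j < k) : gL a (Gg a j * Gg a k) =
    - (2 * ((j : ℝ) + a + 1 / 2) * hn a j) / (((k : ℝ) + a + 1 / 2) ^ 2 - ((j : ℝ) + a + 1 / 2) ^ 2) := by
  rw [← gL_val a j k h]
  have h1 : (j : ℝ) < k := by exact_mod_cast h
  have : ((k : ℝ) + a + 1 / 2) ^ 2 - ((j : ℝ) + a + 1 / 2) ^ 2 ≠ 0 := by
    have : ((k : ℝ) + a + 1 / 2) ^ 2 - ((j : ℝ) + a + 1 / 2) ^ 2 = (k - j) * (k + j + 2 * a + 1) := by ring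
    rw [this]
    have h2 : 0 < (k : ℝ) - j := by linarith
    positivity
  rw [eq_div_iff this]; ring

lemma A_off (a j k : ℕ) (h : j < k) :
    ∫ x in (0 : ℝ)..1, vEnt x * ((1 - x ^ 2) ^ a * (Gg a (2 * j) * Gg a (2 * k)).eval x) =
      - (nd a j) * hn a (2 * j) * Rf a (nd a j) (nd a k) := by
  rw [vint a _ (by intro x; simp [Gg_even_eval])]
  obtain ⟨k, rfl⟩ : ∃ k', k = k' + 1 := ⟨k - 1, by omega⟩
  have hr := Gg_rec a (2 * k + 1)
  have hrec : (1 - X) * (Gg a (2 * j) * Gg a (2 * (k + 1))) =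
      C 1 * (Gg a (2 * j) * Gg a (2 * (k + 1))) - (C ((((2 * k + 1 : ℕ) : ℝ) + 2) / (2 * ((2 * k + 1 : ℕ) : ℝ) + 2 * a + 3)) * (Gg a (2 * j) * Gg a (2 * k + 3))
        + C ((((2 * k + 1 : ℕ) : ℝ) + 1 + 2 * a) / (2 * ((2 * k + 1 : ℕ) : ℝ) + 2 * a + 3)) * (Gg a (2 * j) * Gg a (2 * k + 1))) := by
    have hne : C (2 * ((2 * k + 1 : ℕ) : ℝ) + 2 * a + 3) ≠ 0 := by
      rw [Ne, C_eq_zero]; positivity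
    apply mul_left_cancel₀ hne
    have e1 : C (2 * ((2 * k + 1 : ℕ) : ℝ) + 2 * a + 3) * C ((((2 * k + 1 : ℕ) : ℝ) + 2) / (2 * ((2 * k + 1 : ℕ) : ℝ) + 2 * a + 3)) = C (((2 * k + 1 : ℕ) : ℝ) + 2) := by
      rw [← C_mul, mul_div_cancel₀ _ (by positivity)]
    have e2 : C (2 * ((2 * k + 1 : ℕ) : ℝ) + 2 * a + 3) * C ((((2 * k + 1 : ℕ) : ℝ) + 1 + 2 * a) / (2 * ((2 * k + 1 : ℕ) : ℝ) + 2 * a + 3)) = C (((2 * k + 1 : ℕ) : ℝ) + 1 + 2 * a) := by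
      rw [← C_mul, mul_div_cancel₀ _ (by positivity)]
    rw [C_1]
    have hr' : C (((2 * k + 1 : ℕ) : ℝ) + 2) * Gg a (2 * k + 3) =
      C (2 * ((2 * k + 1 : ℕ) : ℝ) + 2 * a + 3) * X * Gg a (2 * (k + 1)) - C (((2 * k + 1 : ℕ) : ℝ) + 1 + 2 * a) * Gg a (2 * k + 1) := hr
    linear_combination Gg a (2 * j) * hr' + Gg a (2 * j) * Gg a (2 * k + 3) * e1 + Gg a (2 * j) * Gg a (2 * k + 1) * e2
  rw [hrec]
  simp only [gL_sub, gL_add, gL_smul, gJ_sub, gJ_add, gJ_smul]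
  rw [Gg_orth a (2 * j) (2 * (k + 1)) (by omega), Gg_orth a (2 * j) (2 * k + 3) (by omega), Gg_orth a (2 * j) (2 * k + 1) (by omega),
    gL_val' a (2 * j) (2 * (k + 1)) (by omega), gL_val' a (2 * j) (2 * k + 3) (by omega), gL_val' a (2 * j) (2 * k + 1) (by omega)]
  push_cast
  unfold Rf
  have ex : nd a j = 2 * j + a + 1 / 2 := rfl
  obtain ⟨y, hy⟩ : ∃ y, y = nd a (k + 1) := ⟨_, rfl⟩
  have ey : y = 2 * (k + 1) + a + 1 / 2 := by rw [hy]; unfold nd; push_cast; ring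
  rw [← hy, ← ex, ← ey, show 2 * (k : ℝ) + 3 + a + 1 / 2 = y + 1 by rw [ey]; ring,
    show 2 * (k : ℝ) + 1 + a + 1 / 2 = y - 1 by rw [ey]; ring,
    show 2 * (k : ℝ) + 1 + 2 = y + 1 / 2 - a by rw [ey]; ring,
    show 2 * (k : ℝ) + 1 + 1 + 2 * a = y - 1 / 2 + a by rw [ey]; ring,
    show 2 * (2 * (k : ℝ) + 1) + 2 * a + 3 = 2 * y by rw [ey]; ring]
  have hjk : (j : ℝ) ≤ k := by exact_mod_cast (by omega : j ≤ k)
  have hlt : nd a j + 2 ≤ y := by rw [ex, ey]; linarith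
  have hx0 : 0 < nd a j := by unfold nd; positivity
  generalize nd a j = x at *
  generalize hn a (2 * j) = h0
  generalize (a : ℝ) = b at *
  clear ex ey hy hrec hr
  have hy0 : 0 < y := by linarith
  have f1 : y - x ≠ 0 := by linarith
  have f2 : y + x ≠ 0 := by linarith
  have f3 : y - x - 1 ≠ 0 := by linarith
  have f4 : y - x + 1 ≠ 0 := by linarith
  have f5 : y + x - 1 ≠ 0 := by linarith
  have f6 : y + x + 1 ≠ 0 := by linarith
  rw [show y ^ 2 - x ^ 2 = (y - x) * (y + x) by ring, show (y + 1) ^ 2 - x ^ 2 = (y - x + 1) * (y + x + 1) by ring,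
    show (y - 1) ^ 2 - x ^ 2 = (y - x - 1) * (y + x - 1) by ring, show (y - x) ^ 2 - 1 = (y - x - 1) * (y - x + 1) by ring,
    show (y + x) ^ 2 - 1 = (y + x - 1) * (y + x + 1) by ring]
  field_simp
  ring

lemma A_Fa (a j k : ℕ) (h : j < k) :
    (∫ x in (0 : ℝ)..1, vEnt x * ((1 - x ^ 2) ^ a * (Gg a (2 * j) * Gg a (2 * k)).eval x)) ^ 2
      / ((hn a (2 * j) / 2) * (hn a (2 * k) / 2)) = Fa a (nd a j) (nd a k) := by
  rw [A_off a j k h]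
  have h1 := hn_gP a (2 * j)
  have h2 := hn_gP a (2 * k)
  have ej : ((2 * j : ℕ) : ℝ) + a + 1 / 2 = nd a j := by unfold nd; push_cast; ring
  have ek : ((2 * k : ℕ) : ℝ) + a + 1 / 2 = nd a k := by unfold nd; push_cast; ring
  rw [ej] at h1
  rw [ek] at h2
  have p1 := hn_pos a (2 * j)
  have p2 := hn_pos a (2 * k)
  have p0 := hn_pos a 0
  have gk : 0 < gP a (nd a k) := gP_pos a _ (by unfold nd; have : (0 : ℝ) ≤ k := Nat.cast_nonneg k; linarith)
  have g0 : 0 < gP a ((a : ℝ) + 1 / 2) := gP_pos a _ (by linarith)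
  have nk : 0 < nd a k := by unfold nd; positivity
  have nj : 0 < nd a j := by unfold nd; positivity
  unfold Fa
  have h3 : gP a (nd a j) / gP a (nd a k) = (nd a j * hn a (2 * j)) / (nd a k * hn a (2 * k)) := by
    rw [div_eq_div_iff gk.ne' (by positivity)]
    have hz : ((a : ℝ) + 1 / 2) * hn a 0 ≠ 0 := by positivity
    apply mul_left_cancel₀ hz
    linear_combination (-(nd a k * hn a (2 * k))) * h1 + (nd a j * hn a (2 * j)) * h2
  rw [h3]
  field_simp
  ring

end VA
end

section
namespace VA
open MeasureTheory

lemma perm_sum {m : ℕ} (M : Matrix (Fin m) (Fin m) ℝ) :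
    ∑ σ : Equiv.Perm (Fin m), ∑ τ : Equiv.Perm (Fin m),
      ((Equiv.Perm.sign σ : ℤ) : ℝ) * ((Equiv.Perm.sign τ : ℤ) : ℝ) * ∏ i, M (σ i) (τ i)
      = (m.factorial : ℝ) * M.det := by
  rw [Finset.sum_comm]
  have : ∀ τ : Equiv.Perm (Fin m), ∑ σ : Equiv.Perm (Fin m),
      ((Equiv.Perm.sign σ : ℤ) : ℝ) * ((Equiv.Perm.sign τ : ℤ) : ℝ) * ∏ i, M (σ i) (τ i) = M.det := by
    intro τ
    rw [Matrix.det_apply']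
    rw [← Equiv.sum_comp (Equiv.mulRight τ)]
    refine Finset.sum_congr rfl fun σ _ => ?_
    simp only [Equiv.coe_mulRight, Equiv.Perm.sign_mul, Equiv.Perm.coe_mul, Function.comp]
    rw [Equiv.prod_comp τ (fun i => M (σ i) i)]
    have h : ((Equiv.Perm.sign τ : ℤ) : ℝ) * ((Equiv.Perm.sign τ : ℤ) : ℝ) = 1 := by
      rw [← Int.cast_mul, ← Units.val_mul, Int.units_mul_self]; simp
    push_cast
    linear_combination (((Equiv.Perm.sign σ : ℤ) : ℝ) * ∏ i, M (σ i) i) * h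
  rw [Finset.sum_congr rfl fun τ _ => this τ]
  simp [Fintype.card_perm]

lemma det_sq_expand {m : ℕ} (φ : Fin m → ℝ → ℝ) (e : ℝ → ℝ) (x : Fin m → ℝ) :
    (Matrix.of fun i j => φ j (x i)).det ^ 2 * ∏ i, e (x i) =
    ∑ σ : Equiv.Perm (Fin m), ∑ τ : Equiv.Perm (Fin m),
      ((Equiv.Perm.sign σ : ℤ) : ℝ) * ((Equiv.Perm.sign τ : ℤ) : ℝ) *
        ∏ i, (φ (σ i) (x i) * φ (τ i) (x i) * e (x i)) := by
  have hd : (Matrix.of fun i j => φ j (x i)).det = ∑ σ : Equiv.Perm (Fin m),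
      ((Equiv.Perm.sign σ : ℤ) : ℝ) * ∏ i, φ (σ i) (x i) := by
    rw [← Matrix.det_transpose, Matrix.det_apply']
    rfl
  rw [hd, sq, Finset.sum_mul_sum, Finset.sum_mul]
  refine Finset.sum_congr rfl fun σ _ => ?_
  rw [Finset.sum_mul]
  refine Finset.sum_congr rfl fun τ _ => ?_
  rw [Finset.prod_mul_distrib, Finset.prod_mul_distrib]
  ring

lemma term_int {m : ℕ} (φ : Fin m → ℝ → ℝ) (e : ℝ → ℝ)
    (h : ∀ j k, Integrable fun x => φ j x * φ k x * e x) (σ τ : Equiv.Perm (Fin m)) :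
    Integrable fun x : Fin m → ℝ => ∏ i, (φ (σ i) (x i) * φ (τ i) (x i) * e (x i)) :=
  Integrable.fintype_prod (f := fun i x => φ (σ i) x * φ (τ i) x * e x) (fun i => h _ _)

lemma andreief_int {m : ℕ} (φ : Fin m → ℝ → ℝ) (e : ℝ → ℝ)
    (h : ∀ j k, Integrable fun x => φ j x * φ k x * e x) :
    Integrable fun x : Fin m → ℝ => (Matrix.of fun i j => φ j (x i)).det ^ 2 * ∏ i, e (x i) := by
  simp_rw [det_sq_expand]
  exact integrable_finsetSum _ fun σ _ => integrable_finsetSum _ fun τ _ => (term_int φ e h σ τ).const_mul _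

lemma andreief {m : ℕ} (φ : Fin m → ℝ → ℝ) (e : ℝ → ℝ)
    (h : ∀ j k, Integrable fun x => φ j x * φ k x * e x) :
    ∫ x : Fin m → ℝ, (Matrix.of fun i j => φ j (x i)).det ^ 2 * ∏ i, e (x i)
      = (m.factorial : ℝ) * (Matrix.of fun j k => ∫ x, φ j x * φ k x * e x).det := by
  simp_rw [det_sq_expand]
  rw [integral_finsetSum _ fun σ _ => integrable_finsetSum _ fun τ _ => (term_int φ e h σ τ).const_mul _,
    ← perm_sum]
  refine Finset.sum_congr rfl fun σ _ => ?_
  rw [integral_finsetSum _ fun τ _ => (term_int φ e h σ τ).const_mul _]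
  refine Finset.sum_congr rfl fun τ _ => ?_
  rw [integral_const_mul]
  congr 1
  exact integral_fintype_prod_volume_eq_prod (fun i x => φ (σ i) x * φ (τ i) x * e x)

open Polynomial in
lemma esym_poly {m : ℕ} (c : Fin m → ℝ) : ∃ p : ℝ[X], (∀ t, p.eval t = ∏ i, (1 + t * c i)) ∧
    p.coeff 1 = ∑ i, c i ∧ 2 * p.coeff 2 = (∑ i, c i) ^ 2 - ∑ i, c i ^ 2 := by
  have : ∀ s : Finset (Fin m), (∏ i ∈ s, (1 + C (c i) * X)).coeff 0 = 1 ∧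
      (∏ i ∈ s, (1 + C (c i) * X)).coeff 1 = ∑ i ∈ s, c i ∧
      2 * (∏ i ∈ s, (1 + C (c i) * X)).coeff 2 = (∑ i ∈ s, c i) ^ 2 - ∑ i ∈ s, c i ^ 2 := by
    intro s
    induction s using Finset.induction_on with
    | empty => simp [coeff_one]
    | insert i s hi ih =>
      obtain ⟨h0, h1, h2⟩ := ih
      rw [Finset.prod_insert hi, Finset.sum_insert hi, Finset.sum_insert hi]
      generalize ∏ i ∈ s, (1 + C (c i) * X) = q at *
      have e : (1 + C (c i) * X) * q = q + C (c i) * (X * q) := by ring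
      rw [e]
      simp only [coeff_add, coeff_C_mul]
      rw [coeff_X_mul q 1, coeff_X_mul q 0, coeff_X_mul_zero, h0, h1]
      refine ⟨by ring, by ring, ?_⟩
      linear_combination h2
  refine ⟨_, ?_, (this Finset.univ).2⟩
  intro t
  rw [eval_prod]
  refine Finset.prod_congr rfl fun i _ => ?_
  simp; ring

end VA
end

section
namespace VA
open MeasureTheory

open Polynomial in
lemma esym_poly' {m : ℕ} (c : Fin m → ℝ) : ∃ p : ℝ[X], (∀ t, p.eval t = ∏ i, (1 + t * c i)) ∧
    p.degree < ((m + 1 : ℕ) : WithBot ℕ) ∧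
    p.coeff 1 = ∑ i, c i ∧ 2 * p.coeff 2 = (∑ i, c i) ^ 2 - ∑ i, c i ^ 2 := by
  obtain ⟨p, h1, h2⟩ := esym_poly c
  refine ⟨p, h1, ?_, h2⟩
  have : p = ∏ i, (1 + C (c i) * X) := by
    apply Polynomial.funext
    intro t
    rw [h1, eval_prod]
    refine Finset.prod_congr rfl fun i _ => ?_
    simp; ring
  rw [this]
  refine lt_of_le_of_lt (degree_prod_le _ _) ?_
  have hb : ∀ i ∈ (Finset.univ : Finset (Fin m)), (1 + C (c i) * X).degree ≤ 1 := by
    intro i _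
    refine (degree_add_le _ _).trans (max_le ?_ ?_)
    · rw [degree_one]; norm_num
    · exact degree_C_mul_X_le _
  refine lt_of_le_of_lt (Finset.sum_le_card_nsmul _ _ _ hb) ?_
  simp only [Finset.card_univ, Fintype.card_fin, nsmul_eq_mul, mul_one]
  exact_mod_cast Nat.lt_succ_self m

open Polynomial in
lemma coeff_functional (m k : ℕ) : ∃ α : ℕ → ℝ, ∀ p : ℝ[X], p.degree < ((m + 1 : ℕ) : WithBot ℕ) →
    p.coeff k = ∑ r ∈ Finset.range (m + 1), α r * p.eval (r : ℝ) := by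
  refine ⟨fun r => (Lagrange.basis (Finset.range (m + 1)) (fun r : ℕ => (r : ℝ)) r).coeff k, ?_⟩
  intro p hp
  have h := Lagrange.eq_interpolate (s := Finset.range (m + 1)) (v := fun r : ℕ => (r : ℝ)) (f := p)
    (fun a _ b _ h => by simpa using h) (by simpa using hp)
  conv_lhs => rw [h]
  rw [Lagrange.interpolate_apply, finsetSum_coeff]
  refine Finset.sum_congr rfl fun r _ => ?_
  rw [coeff_C_mul, mul_comm]

/-- extraction of the first two elementary symmetric moments -/
lemma extract {m : ℕ} (D : (Fin m → ℝ) → ℝ) (v : ℝ → ℝ) (K : ℝ) (l : Fin m → ℝ)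
    (hI : ∀ t : ℝ, Integrable fun x => D x * ∏ i, (1 + t * v (x i)))
    (hE : ∀ t : ℝ, ∫ x, D x * ∏ i, (1 + t * v (x i)) = K * ∏ i, (1 + t * l i)) :
    (Integrable fun x => D x * ∑ i, v (x i)) ∧ (∫ x, D x * ∑ i, v (x i) = K * ∑ i, l i) ∧
    (Integrable fun x => D x * ((∑ i, v (x i)) ^ 2 - ∑ i, v (x i) ^ 2)) ∧
    (∫ x, D x * ((∑ i, v (x i)) ^ 2 - ∑ i, v (x i) ^ 2) = K * ((∑ i, l i) ^ 2 - ∑ i, l i ^ 2)) := by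
  have gen : ∀ k, ∃ α : ℕ → ℝ, ∀ c : Fin m → ℝ, ∃ p : Polynomial ℝ,
      p.coeff k = ∑ r ∈ Finset.range (m + 1), α r * ∏ i, (1 + (r : ℝ) * c i) ∧
      p.coeff 1 = ∑ i, c i ∧ 2 * p.coeff 2 = (∑ i, c i) ^ 2 - ∑ i, c i ^ 2 := by
    intro k
    obtain ⟨α, hα⟩ := coeff_functional m k
    refine ⟨α, fun c => ?_⟩
    obtain ⟨p, h1, h2, h3⟩ := esym_poly' c
    refine ⟨p, ?_, h3⟩
    rw [hα p h2]; simp_rw [h1]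
  have main : ∀ (α : ℕ → ℝ), (Integrable fun x => D x * ∑ r ∈ Finset.range (m + 1), α r * ∏ i, (1 + (r : ℝ) * v (x i))) ∧
      ∫ x, D x * ∑ r ∈ Finset.range (m + 1), α r * ∏ i, (1 + (r : ℝ) * v (x i))
      = K * ∑ r ∈ Finset.range (m + 1), α r * ∏ i, (1 + (r : ℝ) * l i) := by
    intro α
    have e : ∀ x : Fin m → ℝ, D x * ∑ r ∈ Finset.range (m + 1), α r * ∏ i, (1 + (r : ℝ) * v (x i))
      = ∑ r ∈ Finset.range (m + 1), α r * (D x * ∏ i, (1 + (r : ℝ) * v (x i))) := by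
      intro x; rw [Finset.mul_sum]; refine Finset.sum_congr rfl fun r _ => by ring
    simp_rw [e]
    refine ⟨integrable_finsetSum _ fun (r : ℕ) _ => (hI (r : ℝ)).const_mul _, ?_⟩
    rw [integral_finsetSum _ fun (r : ℕ) _ => (hI (r : ℝ)).const_mul _, Finset.mul_sum]
    refine Finset.sum_congr rfl fun r _ => ?_
    rw [integral_const_mul, hE]; ring
  obtain ⟨α, hα⟩ := gen 1
  obtain ⟨β, hβ⟩ := gen 2
  have a1 : ∀ c : Fin m → ℝ, ∑ r ∈ Finset.range (m + 1), α r * ∏ i, (1 + (r : ℝ) * c i) = ∑ i, c i := by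
    intro c; obtain ⟨p, h1, h2, _⟩ := hα c; rw [← h1, h2]
  have b1 : ∀ c : Fin m → ℝ, ∑ r ∈ Finset.range (m + 1), (2 * β r) * ∏ i, (1 + (r : ℝ) * c i)
      = (∑ i, c i) ^ 2 - ∑ i, c i ^ 2 := by
    intro c; obtain ⟨p, h1, _, h2⟩ := hβ c; rw [← h2, h1, Finset.mul_sum]
    refine Finset.sum_congr rfl fun r _ => by ring
  have m1 := main α
  have m2 := main fun r => 2 * β r
  simp only [a1] at m1
  simp only [b1] at m2
  exact ⟨m1.1, m1.2, m2.1, m2.2⟩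

lemma sym_eig {m : ℕ} (A : Matrix (Fin m) (Fin m) ℝ) (hA : ∀ j k, A j k = A k j) :
    ∃ l : Fin m → ℝ, (∀ t : ℝ, (1 + t • A).det = ∏ i, (1 + t * l i)) ∧ ∑ i, l i = ∑ i, A i i ∧
      ∑ i, l i ^ 2 = ∑ i, ∑ j, A i j ^ 2 := by
  have hH : A.IsHermitian := by
    ext i j; simp [Matrix.conjTranspose_apply, hA i j]
  have hs := hH.spectral_theorem
  set U : Matrix (Fin m) (Fin m) ℝ := (hH.eigenvectorUnitary : Matrix (Fin m) (Fin m) ℝ) with hU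
  have hUU : U * star U = 1 := Unitary.mul_star_self_of_mem hH.eigenvectorUnitary.2
  have hUU' : star U * U = 1 := Unitary.star_mul_self_of_mem hH.eigenvectorUnitary.2
  have hs' : A = U * Matrix.diagonal hH.eigenvalues * star U := by
    simpa [Unitary.conjStarAlgAut_apply, Function.comp_def] using hs
  refine ⟨hH.eigenvalues, ?_, ?_, ?_⟩
  · intro t
    have : 1 + t • A = U * (Matrix.diagonal fun i => 1 + t * hH.eigenvalues i) * star U := by
      have hd : (Matrix.diagonal fun i => 1 + t * hH.eigenvalues i) = 1 + t • Matrix.diagonal hH.eigenvalues := by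
        ext i j
        by_cases h : i = j
        · subst h; simp
        · simp [h]
      rw [hd, mul_add, add_mul, mul_one, hUU, mul_smul_comm, smul_mul_assoc, ← hs']
    rw [this, Matrix.det_mul, Matrix.det_mul, mul_right_comm, ← Matrix.det_mul, hUU, Matrix.det_one, one_mul,
      Matrix.det_diagonal]
  · have := hH.trace_eq_sum_eigenvalues
    simpa [Matrix.trace] using this.symm
  · have h1 : (A * A).trace = ∑ i, ∑ j, A i j ^ 2 := by
      simp only [Matrix.trace, Matrix.diag, Matrix.mul_apply]
      refine Finset.sum_congr rfl fun i _ => Finset.sum_congr rfl fun j _ => ?_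
      rw [hA j i]; ring
    rw [← h1]
    have h2 : A * A = U * (Matrix.diagonal hH.eigenvalues * Matrix.diagonal hH.eigenvalues) * star U := by
      conv_lhs => rw [hs']
      calc U * Matrix.diagonal hH.eigenvalues * star U * (U * Matrix.diagonal hH.eigenvalues * star U)
          = U * Matrix.diagonal hH.eigenvalues * (star U * U) * Matrix.diagonal hH.eigenvalues * star U := by
            simp only [mul_assoc]
        _ = _ := by rw [hUU']; simp only [mul_one, mul_assoc]
    rw [h2, Matrix.trace_mul_comm, ← mul_assoc, hUU', one_mul, Matrix.diagonal_mul_diagonal, Matrix.trace_diagonal]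
    refine Finset.sum_congr rfl fun i _ => by ring

/-- The determinantal variance formula. -/
lemma det_var {m : ℕ} (φ : Fin m → ℝ → ℝ) (w v : ℝ → ℝ)
    (h0 : ∀ j k, Integrable fun x => φ j x * φ k x * w x)
    (h1 : ∀ j k, Integrable fun x => φ j x * φ k x * (v x * w x))
    (h2 : ∀ j k, Integrable fun x => φ j x * φ k x * (v x ^ 2 * w x))
    (ho : ∀ j k, ∫ x, φ j x * φ k x * w x = if j = k then 1 else 0) :
    let D : (Fin m → ℝ) → ℝ := fun x => (Matrix.of fun i j => φ j (x i)).det ^ 2 * ∏ i, w (x i)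
    (∫ x, D x = m.factorial) ∧
    (∫ x, D x * ∑ i, v (x i) = m.factorial * ∑ i, ∫ x, φ i x * φ i x * (v x * w x)) ∧
    (∫ x, D x * (∑ i, v (x i)) ^ 2 = m.factorial *
      ((∑ i, ∫ x, φ i x * φ i x * (v x * w x)) ^ 2 + (∑ i, ∫ x, φ i x * φ i x * (v x ^ 2 * w x))
        - ∑ i, ∑ j, (∫ x, φ i x * φ j x * (v x * w x)) ^ 2)) := by
  intro D
  have gen : ∀ u : ℝ → ℝ, (∀ j k, Integrable fun x => φ j x * φ k x * (u x * w x)) →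
      ∃ l : Fin m → ℝ, (∀ t : ℝ, Integrable fun x => D x * ∏ i, (1 + t * u (x i))) ∧
      (∀ t : ℝ, ∫ x, D x * ∏ i, (1 + t * u (x i)) = m.factorial * ∏ i, (1 + t * l i)) ∧
      (∑ i, l i = ∑ i, ∫ x, φ i x * φ i x * (u x * w x)) ∧
      (∑ i, l i ^ 2 = ∑ i, ∑ j, (∫ x, φ i x * φ j x * (u x * w x)) ^ 2) := by
    intro u hu
    obtain ⟨l, l1, l2, l3⟩ := sym_eig (Matrix.of fun j k => ∫ x, φ j x * φ k x * (u x * w x)) (by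
      intro j k; simp only [Matrix.of_apply]; congr 1; ext x; ring)
    have e : ∀ (t : ℝ) (x : Fin m → ℝ), D x * ∏ i, (1 + t * u (x i)) =
        (Matrix.of fun i j => φ j (x i)).det ^ 2 * ∏ i, (fun y => (1 + t * u y) * w y) (x i) := by
      intro t x
      simp only [D, Finset.prod_mul_distrib]; ring
    have e2 : ∀ (t : ℝ) j k, (fun x => φ j x * φ k x * ((1 + t * u x) * w x)) =
        fun x => φ j x * φ k x * w x + t * (φ j x * φ k x * (u x * w x)) := by
      intro t j k; ext x; ring
    have hi : ∀ (t : ℝ) j k, Integrable fun x => φ j x * φ k x * ((1 + t * u x) * w x) := by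
      intro t j k; rw [e2]; exact (h0 j k).add ((hu j k).const_mul t)
    refine ⟨l, ?_, ?_, l2, l3⟩
    · intro t; simp_rw [e]
      exact andreief_int φ _ (hi t)
    · intro t
      simp_rw [e]
      rw [andreief φ _ (hi t), ← l1]
      congr 2
      ext j k
      simp only [Matrix.of_apply, e2]
      rw [integral_add (h0 j k) ((hu j k).const_mul t), integral_const_mul, ho]
      simp [Matrix.one_apply]
  obtain ⟨l, a1, a2, a3, a4⟩ := gen v h1
  obtain ⟨l', b1, b2, b3, b4⟩ := gen (fun x => v x ^ 2) h2
  obtain ⟨c1, c2, c3, c4⟩ := extract D v _ l a1 a2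
  obtain ⟨d1, d2, _⟩ := extract D (fun x => v x ^ 2) _ l' b1 b2
  refine ⟨?_, ?_, ?_⟩
  · have := a2 0; simpa using this
  · rw [c2, a3]
  · have : ∀ x : Fin m → ℝ, D x * (∑ i, v (x i)) ^ 2 =
      D x * ((∑ i, v (x i)) ^ 2 - ∑ i, v (x i) ^ 2) + D x * ∑ i, v (x i) ^ 2 := by intro x; ring
    simp_rw [this]
    rw [integral_add c3 d1, c4, d2, a3, b3, a4]; ring

end VA
end

section
namespace VA
open MeasureTheory Polynomial

noncomputable def ip (a : ℕ) (f g : ℝ → ℝ) : ℝ := ∫ x in (0 : ℝ)..1, f x * g x * (1 - x ^ 2) ^ a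

noncomputable def ph (a k : ℕ) (x : ℝ) : ℝ := (Gg a (2 * k)).eval x / Real.sqrt (hn a (2 * k) / 2)

lemma ph_cont (a k : ℕ) : Continuous (ph a k) := by unfold ph; fun_prop

lemma ph_orth (a j k : ℕ) : ip a (ph a j) (ph a k) = if j = k then 1 else 0 := by
  have h1 : ip a (ph a j) (ph a k) = (gJ a (Gg a (2 * j) * Gg a (2 * k)) / 2) /
      (Real.sqrt (hn a (2 * j) / 2) * Real.sqrt (hn a (2 * k) / 2)) := by
    rw [← half_int a _ (by intro x; simp [Gg_even_eval]), ← intervalIntegral.integral_div]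
    unfold ip ph
    congr 1; ext x; simp only [eval_mul]; ring
  rw [h1]
  by_cases h : j = k
  · subst h
    have := hn_pos a (2 * j)
    rw [if_pos rfl, Real.mul_self_sqrt (by positivity)]
    show hn a (2 * j) / 2 / (hn a (2 * j) / 2) = 1
    exact div_self (by positivity)
  · rw [if_neg h, Gg_orth a _ _ (by omega)]; simp

lemma ip_int (a : ℕ) {f g : ℝ → ℝ} (hf : Continuous f) (hg : Continuous g) :
    IntervalIntegrable (fun x => f x * g x * (1 - x ^ 2) ^ a) volume 0 1 := by
  apply Continuous.intervalIntegrable; fun_prop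

lemma ip_comm (a : ℕ) (f g : ℝ → ℝ) : ip a f g = ip a g f := by
  unfold ip; congr 1; ext x; ring

lemma ip_sub_left (a : ℕ) {f g h : ℝ → ℝ} (hf : Continuous f) (hg : Continuous g) (hh : Continuous h) :
    ip a (fun x => f x - g x) h = ip a f h - ip a g h := by
  unfold ip
  rw [← intervalIntegral.integral_sub (ip_int a hf hh) (ip_int a hg hh)]
  congr 1; ext x; ring

lemma ip_sum_left (a N : ℕ) (c : ℕ → ℝ) {h : ℝ → ℝ} (hh : Continuous h) :
    ip a (fun x => ∑ k ∈ Finset.range N, c k * ph a k x) h = ∑ k ∈ Finset.range N, c k * ip a (ph a k) h := by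
  unfold ip
  simp_rw [Finset.sum_mul]
  rw [intervalIntegral.integral_finsetSum]
  · refine Finset.sum_congr rfl fun k _ => ?_
    rw [← intervalIntegral.integral_const_mul]
    congr 1; ext x; ring
  · intro k _
    have := ph_cont a k
    apply Continuous.intervalIntegrable; fun_prop

lemma ip_best (a N : ℕ) (c : ℕ → ℝ) {f : ℝ → ℝ} (hf : Continuous f) :
    ip a (fun x => f x - ∑ k ∈ Finset.range N, c k * ph a k x) (fun x => f x - ∑ k ∈ Finset.range N, c k * ph a k x)
      = ip a f f - ∑ k ∈ Finset.range N, ip a f (ph a k) ^ 2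
        + ∑ k ∈ Finset.range N, (c k - ip a f (ph a k)) ^ 2 := by
  have hs : Continuous fun x => ∑ k ∈ Finset.range N, c k * ph a k x :=
    continuous_finset_sum _ fun k _ => (ph_cont a k).const_mul _ |> fun h => h
  have h1 : ip a f (fun x => ∑ k ∈ Finset.range N, c k * ph a k x) = ∑ k ∈ Finset.range N, c k * ip a f (ph a k) := by
    rw [ip_comm, ip_sum_left a N c hf]
    exact Finset.sum_congr rfl fun k _ => by rw [ip_comm]
  have h2 : ip a (fun x => ∑ k ∈ Finset.range N, c k * ph a k x) (fun x => ∑ k ∈ Finset.range N, c k * ph a k x)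
      = ∑ k ∈ Finset.range N, c k ^ 2 := by
    rw [ip_sum_left a N c hs]
    refine Finset.sum_congr rfl fun k hk => ?_
    rw [ip_comm, ip_sum_left a N c (ph_cont a k)]
    simp_rw [ph_orth]
    simp [Finset.mem_range.mp hk, sq]
  have hsub : Continuous fun x => f x - ∑ k ∈ Finset.range N, c k * ph a k x := hf.sub hs
  rw [ip_sub_left a hf hs hsub, ip_comm a f, ip_comm a _ (fun x => f x - _),
    ip_sub_left a hf hs hf, ip_sub_left a hf hs hs, h2]
  have h1' := ip_comm a f (fun x => ∑ k ∈ Finset.range N, c k * ph a k x)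
  have : ∑ x ∈ Finset.range N, (ip a f (ph a x) ^ 2 - (c x - ip a f (ph a x)) ^ 2)
      = ∑ k ∈ Finset.range N, c k * ip a f (ph a k) + (∑ k ∈ Finset.range N, c k * ip a f (ph a k)
        - ∑ k ∈ Finset.range N, c k ^ 2) := by
    rw [← Finset.sum_sub_distrib, ← Finset.sum_add_distrib]
    exact Finset.sum_congr rfl fun k _ => by ring
  rw [Finset.sum_sub_distrib] at this
  linarith

lemma ip_self_nonneg (a : ℕ) (f : ℝ → ℝ) : 0 ≤ ip a f f := by
  unfold ip
  apply intervalIntegral.integral_nonneg (by norm_num)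
  intro x hx
  have : 0 ≤ 1 - x ^ 2 := by nlinarith [hx.1, hx.2]
  have := mul_self_nonneg (f x)
  positivity

lemma ip_self_le (a : ℕ) {f : ℝ → ℝ} (hf : Continuous f) (ε : ℝ) (h : ∀ x ∈ Set.Icc (0 : ℝ) 1, |f x| ≤ ε) :
    ip a f f ≤ ε ^ 2 := by
  have : ip a f f ≤ ∫ x in (0 : ℝ)..1, ε ^ 2 := by
    unfold ip
    apply intervalIntegral.integral_mono_on (by norm_num) (ip_int a hf hf) (by simp)
    intro x hx
    have h0 : 0 ≤ 1 - x ^ 2 := by nlinarith [hx.1, hx.2]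
    have h1 : (1 - x ^ 2) ^ a ≤ 1 := pow_le_one₀ h0 (by nlinarith [sq_nonneg x])
    have h2 : f x * f x ≤ ε ^ 2 := by
      rw [← sq, ← sq_abs]; gcongr; exact h x hx
    calc f x * f x * (1 - x ^ 2) ^ a ≤ f x * f x * 1 := by gcongr; exact mul_self_nonneg _
      _ ≤ ε ^ 2 := by linarith
  simpa using this

lemma span_ph (a N : ℕ) : ∀ p : ℝ[X], p.degree < (N : WithBot ℕ) →
    ∃ c : ℕ → ℝ, ∀ x, p.eval (x ^ 2) = ∑ k ∈ Finset.range N, c k * ph a k x := by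
  induction N with
  | zero =>
    intro p hp
    have : p = 0 := by
      rw [← degree_eq_bot]
      simpa using hp
    exact ⟨0, by simp [this]⟩
  | succ N ih =>
    intro p hp
    obtain ⟨G, H, hG, _, dG, cG, _⟩ := Gg_even_odd a N
    have hq : (p - C (p.coeff N / G.coeff N) * G).degree < (N : WithBot ℕ) := by
      rw [degree_lt_iff_coeff_zero]
      intro j hj
      rw [coeff_sub, coeff_C_mul]
      rcases eq_or_lt_of_le hj with h | h
      · subst h; field_simp; ring
      · rw [coeff_eq_zero_of_natDegree_lt (p := G) (n := j) (lt_of_le_of_lt dG h)]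
        rw [degree_lt_iff_coeff_zero] at hp
        rw [hp j h]; ring
    obtain ⟨c, hc⟩ := ih _ hq
    have hs : 0 < Real.sqrt (hn a (2 * N) / 2) := Real.sqrt_pos.mpr (by have := hn_pos a (2 * N); positivity)
    refine ⟨fun k => if k = N then p.coeff N / G.coeff N * Real.sqrt (hn a (2 * N) / 2) else c k, fun x => ?_⟩
    rw [Finset.sum_range_succ]
    beta_reduce
    rw [if_pos rfl]
    have e1 : ∑ k ∈ Finset.range N, (if k = N then p.coeff N / G.coeff N * Real.sqrt (hn a (2 * N) / 2) else c k) * ph a k x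
        = ∑ k ∈ Finset.range N, c k * ph a k x := by
      refine Finset.sum_congr rfl fun k hk => ?_
      rw [if_neg (by have := Finset.mem_range.mp hk; omega)]
    rw [e1, ← hc]
    unfold ph
    rw [hG]
    simp only [eval_sub, eval_mul, eval_C, eval_comp, eval_pow, eval_X]
    field_simp
    ring

lemma parseval (a : ℕ) {f : ℝ → ℝ} (hf : Continuous f) : HasSum (fun k => ip a f (ph a k) ^ 2) (ip a f f) := by
  rw [hasSum_iff_tendsto_nat_of_nonneg (fun _ => sq_nonneg _)]
  have hub : ∀ N, ∑ k ∈ Finset.range N, ip a f (ph a k) ^ 2 ≤ ip a f f := by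
    intro N
    have h := ip_best a N (fun k => ip a f (ph a k)) hf
    have h2 := ip_self_nonneg a (fun x => f x - ∑ k ∈ Finset.range N, ip a f (ph a k) * ph a k x)
    simp at h
    linarith
  rw [Metric.tendsto_atTop]
  intro ε hε
  have hδ : 0 < Real.sqrt (ε / 2) := Real.sqrt_pos.mpr (by positivity)
  obtain ⟨p, hp⟩ := exists_polynomial_near_of_continuousOn 0 1 (fun t => f (Real.sqrt t))
    (hf.comp Real.continuous_sqrt).continuousOn _ hδ
  refine ⟨p.natDegree + 1, fun N hN => ?_⟩
  obtain ⟨c, hc⟩ := span_ph a N p (lt_of_le_of_lt degree_le_natDegree (by exact_mod_cast hN))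
  have h := ip_best a N c hf
  have hcont : Continuous fun x => f x - ∑ k ∈ Finset.range N, c k * ph a k x := by
    simp_rw [← hc]; fun_prop
  have h3 := ip_self_le a hcont (Real.sqrt (ε / 2)) (by
    intro x hx
    rw [← hc, abs_sub_comm]
    have := hp (x ^ 2) ⟨by positivity, by nlinarith [hx.1, hx.2]⟩
    rw [Real.sqrt_sq hx.1] at this
    exact this.le)
  rw [Real.sq_sqrt (by positivity)] at h3
  have h4 : 0 ≤ ∑ k ∈ Finset.range N, (c k - ip a f (ph a k)) ^ 2 := Finset.sum_nonneg fun _ _ => sq_nonneg _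
  rw [Real.dist_eq, abs_lt]
  constructor <;> linarith [hub N]

lemma ip_vph (a j k : ℕ) (h : j < k) : ip a (fun x => vEnt x * ph a j x) (ph a k) ^ 2 = Fa a (nd a j) (nd a k) := by
  rw [← A_Fa a j k h]
  have p1 := hn_pos a (2 * j)
  have p2 := hn_pos a (2 * k)
  have : ip a (fun x => vEnt x * ph a j x) (ph a k) =
      (∫ x in (0 : ℝ)..1, vEnt x * ((1 - x ^ 2) ^ a * (Gg a (2 * j) * Gg a (2 * k)).eval x)) /
      (Real.sqrt (hn a (2 * j) / 2) * Real.sqrt (hn a (2 * k) / 2)) := by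
    rw [← intervalIntegral.integral_div]
    unfold ip ph
    congr 1; ext x; simp only [eval_mul]; ring
  rw [this, div_pow, mul_pow, Real.sq_sqrt (by positivity), Real.sq_sqrt (by positivity)]

lemma var_sum (a m : ℕ) : (∑ i : Fin m, ip a (fun x => vEnt x * ph a i x) (fun x => vEnt x * ph a i x))
    - ∑ i : Fin m, ∑ j : Fin m, ip a (fun x => vEnt x * ph a i x) (ph a j) ^ 2 = Vs a m := by
  rw [← Finset.sum_sub_distrib, Finset.sum_fin_eq_sum_range, Vs]
  refine Finset.sum_congr rfl fun i hi => ?_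
  have hi := Finset.mem_range.mp hi
  rw [dif_pos hi]
  have hf : Continuous fun x => vEnt x * ph a i x := vEnt_cont.mul (ph_cont a i)
  have h := parseval a hf
  have h2 := h.summable.sum_add_tsum_nat_add m
  rw [h.tsum_eq] at h2
  simp only
  rw [← h2, Fin.sum_univ_eq_sum_range (fun j => ip a (fun x => vEnt x * ph a i x) (ph a j) ^ 2), add_sub_cancel_left]
  refine tsum_congr fun k => ?_
  rw [ip_vph a i _ (by omega), add_comm k m]

end VA
end

section
namespace VA
open MeasureTheory Polynomial

noncomputable def Wt (a : ℕ) : ℝ → ℝ := (Set.Icc (0 : ℝ) 1).indicator fun x => (1 - x ^ 2) ^ a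

lemma Wt_mul (a : ℕ) (f : ℝ → ℝ) : (fun x => f x * Wt a x) =
    (Set.Icc (0 : ℝ) 1).indicator fun x => f x * (1 - x ^ 2) ^ a := by
  ext x; unfold Wt
  by_cases h : x ∈ Set.Icc (0 : ℝ) 1
  · rw [Set.indicator_of_mem h, Set.indicator_of_mem h]
  · rw [Set.indicator_of_notMem h, Set.indicator_of_notMem h, mul_zero]

lemma Wt_integrable (a : ℕ) {f : ℝ → ℝ} (hf : Continuous f) : Integrable fun x => f x * Wt a x := by
  rw [Wt_mul, integrable_indicator_iff measurableSet_Icc]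
  apply Continuous.integrableOn_Icc; fun_prop

lemma Wt_integral (a : ℕ) (f : ℝ → ℝ) : ∫ x, f x * Wt a x = ∫ x in (0 : ℝ)..1, f x * (1 - x ^ 2) ^ a := by
  rw [Wt_mul, integral_indicator measurableSet_Icc, integral_Icc_eq_integral_Ioc,
    intervalIntegral.integral_of_le (by norm_num)]

lemma D_density (m n : ℕ) : ∃ K : ℝ, ∀ x : Fin m → ℝ,
    (Matrix.of fun i j : Fin m => ph (n - m) j (x i)).det ^ 2 * ∏ i, Wt (n - m) (x i) = K * densityA m n x := by
  set a := n - m with ha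
  choose G H hG _ dG _ using fun k => Gg_even_odd a k
  refine ⟨(Matrix.of (fun (i j : Fin m) => (C (1 / Real.sqrt (hn a (2 * j) / 2)) * G j).coeff i)).det ^ 2, fun x => ?_⟩
  have h1 : (Matrix.of fun i j : Fin m => ph a j (x i)) = Matrix.of (fun i j : Fin m =>
      ((C (1 / Real.sqrt (hn a (2 * j) / 2)) * G j).eval (x i ^ 2))) := by
    ext i j
    simp only [Matrix.of_apply, ph, hG, eval_comp, eval_pow, eval_X, eval_mul, eval_C]
    ring
  rw [h1, Matrix.eval_matrixOfPolynomials_eq_vandermonde_mul_matrixOfPolynomials (fun i => x i ^ 2)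
    (fun j : Fin m => C (1 / Real.sqrt (hn a (2 * j) / 2)) * G j)
    (fun i => (natDegree_C_mul_le _ _).trans (dG i)), Matrix.det_mul, Matrix.det_vandermonde]
  have h2 : (∏ i : Fin m, ∏ j ∈ Finset.Ioi i, (x j ^ 2 - x i ^ 2)) ^ 2 =
      ∏ p ∈ Finset.univ.filter (fun p : Fin m × Fin m => p.1 < p.2), ((x p.1) ^ 2 - (x p.2) ^ 2) ^ 2 := by
    rw [Finset.prod_finset_product' (Finset.univ.filter (fun p : Fin m × Fin m => p.1 < p.2)) Finset.univ
      (fun i => Finset.Ioi i) (by simp) (f := fun i j => ((x i) ^ 2 - (x j) ^ 2) ^ 2)]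
    simp_rw [← Finset.prod_pow]
    refine Finset.prod_congr rfl fun i _ => Finset.prod_congr rfl fun j _ => by ring
  rw [mul_pow, h2]
  unfold densityA
  by_cases h : ∀ i, x i ∈ Set.Icc (0 : ℝ) 1
  · rw [if_pos h]
    have : ∏ i, Wt a (x i) = ∏ i, (1 - (x i) ^ 2) ^ (n - m) :=
      Finset.prod_congr rfl fun i _ => Set.indicator_of_mem (h i) _
    rw [this]; ring
  · rw [if_neg h]
    push Not at h
    obtain ⟨i, hi⟩ := h
    rw [Finset.prod_eq_zero (Finset.mem_univ i) (Set.indicator_of_notMem hi _)]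
    ring

lemma var_eq (m n : ℕ) : ensembleVar (densityA m n) entS = Vs (n - m) m := by
  obtain ⟨K, hK⟩ := D_density m n
  rw [← var_sum]
  generalize n - m = a at *
  have hc := ph_cont a
  have hv := vEnt_cont
  obtain ⟨d0, d1, d2⟩ := det_var (fun j : Fin m => ph a j) (Wt a) vEnt
    (fun j k => Wt_integrable a (f := fun x => ph a j x * ph a k x) (by fun_prop))
    (fun j k => by
      have := Wt_integrable a (f := fun x => ph a j x * ph a k x * vEnt x) (by fun_prop)
      simpa [mul_assoc] using this)
    (fun j k => by
      have := Wt_integrable a (f := fun x => ph a j x * ph a k x * vEnt x ^ 2) (by fun_prop)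
      simpa [mul_assoc] using this)
    (fun j k => by
      rw [Wt_integral a (fun x => ph a j x * ph a k x)]
      have := ph_orth a j k
      unfold ip at this
      rw [this]
      simp [Fin.ext_iff])
  simp only [hK] at d0 d1 d2
  have eB : ∀ i : Fin m, ∫ x, ph a i x * ph a i x * (vEnt x ^ 2 * Wt a x) =
      ip a (fun x => vEnt x * ph a i x) (fun x => vEnt x * ph a i x) := by
    intro i
    unfold ip
    rw [← Wt_integral a (fun x => (vEnt x * ph a i x) * (vEnt x * ph a i x))]
    congr 1; ext x; ring
  have eA : ∀ i j : Fin m, ∫ x, ph a i x * ph a j x * (vEnt x * Wt a x) =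
      ip a (fun x => vEnt x * ph a i x) (ph a j) := by
    intro i j
    unfold ip
    rw [← Wt_integral a (fun x => (vEnt x * ph a i x) * ph a j x)]
    congr 1; ext x; ring
  simp only [eA, eB] at d1 d2
  simp only [mul_assoc] at d0 d1 d2
  rw [integral_const_mul] at d0 d1 d2
  have hm : (m.factorial : ℝ) ≠ 0 := by exact_mod_cast m.factorial_ne_zero
  unfold ensembleVar ensembleAvg entS
  have s1 : ∫ x : Fin m → ℝ, (-∑ i, vEnt (x i)) ^ 2 * densityA m n x
      = ∫ x, densityA m n x * (∑ i, vEnt (x i)) ^ 2 := by congr 1; ext x; ring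
  have s2 : ∫ x : Fin m → ℝ, (-∑ i, vEnt (x i)) * densityA m n x
      = - ∫ x, densityA m n x * (∑ i, vEnt (x i)) := by
    rw [← integral_neg]; congr 1; ext x; ring
  rw [s1, s2]
  generalize (∫ x : Fin m → ℝ, densityA m n x) = I0 at *
  generalize (∫ x : Fin m → ℝ, densityA m n x * ∑ i, vEnt (x i)) = I1 at *
  generalize (∫ x : Fin m → ℝ, densityA m n x * (∑ i, vEnt (x i)) ^ 2) = I2 at *
  generalize (m.factorial : ℝ) = F at *
  have hK0 : K ≠ 0 := by rintro rfl; simp at d0; exact hm d0.symm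
  have hI0 : I0 ≠ 0 := by rintro rfl; simp at d0; exact hm d0.symm
  rw [← d0] at d1 d2
  have e1 : I1 / I0 = ∑ i : Fin m, ip a (fun x => vEnt x * ph a i x) (ph a i) := by
    rw [div_eq_iff hI0]; apply mul_left_cancel₀ hK0; linear_combination d1
  have e2 := mul_left_cancel₀ hK0 (d2.trans (mul_assoc _ _ _))
  rw [neg_div, neg_sq, e1, e2, mul_div_cancel_left₀ _ hI0]
  ring

end VA
end

theorem var_vonNeumann_entropy_caseA (m n : ℕ) (hm : 1 ≤ m) (hmn : m ≤ n) :
    ensembleVar (densityA m n) entS =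
      (1 / 2 - (m : ℝ) - n) * psi1 (2 * m + 2 * n) + ((n : ℝ) - 1 / 2) * psi1 (2 * n)
        + ((m : ℝ) * (2 * m + n - 1) / (2 * m + 2 * n - 1) - 1 / 8) * psi1 (m + n)
        + psi1 n / 8 - 1 / 2 * (psi0 (2 * m + 2 * n) - psi0 (2 * n)) := by
  rw [VA.var_eq, VA.Vs_eq (n - m) m hm, show m + (n - m) = n by omega]
  rfl
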